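/- arXiv:1307.3068 — 3 statements merged into one kernel-verified Lean document; each statement's English description precedes it below -/
import Mathlib

section
/- Let L > 0 and let η : ℝ → ℝ be continuously differentiable with ∫₀^L cos η(u) du = 0, ∫₀^L sin η(u) du = 0, and suppose the closed curve Γ(s) = (∫₀^s cos η(u) du, -∫₀^s sin η(u) du), s ∈ [0,L], is simple. Then ∫₀^L ( sin η(u) · ∫₀^u cos η(t) dt ) du ≠ 0. -/
open Set Filter Topology MeasureTheory Metric

namespace PlaneCurve

/-- The unit vector with angle `-η s`. -/
noncomputable def tangent (η : ℝ → ℝ) (s : ℝ) : ℂ := Complex.exp (((-η s : ℝ) : ℂ) * Complex.I)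

/-- The unit-speed curve starting at the origin whose tangent has angle `-η`. -/
noncomputable def curve (η : ℝ → ℝ) (s : ℝ) : ℂ := ∫ u in (0 : ℝ)..s, tangent η u

/-- The Cauchy integral `∫ dz / (z - p)` along the arc of `curve η` over `[a, b]`. -/
noncomputable def cauchy (η : ℝ → ℝ) (a b : ℝ) (p : ℂ) : ℂ :=
  ∫ s in a..b, tangent η s / (curve η s - p)

/-- The winding number of the arc `curve η` over `[0, L]` around `p`. -/
noncomputable def winding (η : ℝ → ℝ) (L : ℝ) (p : ℂ) : ℝ :=
  (cauchy η 0 L p).im / (2 * Real.pi)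

/-- The points visited by `curve η` on `[0, L]`. -/
def trace (η : ℝ → ℝ) (L : ℝ) : Set ℂ := curve η '' Icc 0 L

variable {η : ℝ → ℝ}

lemma norm_tangent (s : ℝ) : ‖tangent η s‖ = 1 := Complex.norm_exp_ofReal_mul_I _

lemma tangent_ne_zero (s : ℝ) : tangent η s ≠ 0 := Complex.exp_ne_zero _

lemma continuous_tangent (hη : Continuous η) : Continuous (tangent η) := by
  unfold tangent; fun_prop

lemma hasDerivAt_curve (hη : Continuous η) (s : ℝ) : HasDerivAt (curve η) (tangent η s) s :=
  ((continuous_tangent hη).integral_hasStrictDerivAt 0 s).hasDerivAt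

lemma continuous_curve (hη : Continuous η) : Continuous (curve η) :=
  continuous_iff_continuousAt.2 fun s => (hasDerivAt_curve hη s).continuousAt

lemma curve_sub (hη : Continuous η) (s u : ℝ) :
    curve η u - curve η s = ∫ v in s..u, tangent η v := by
  have h := (continuous_tangent hη).intervalIntegrable (μ := volume)
  exact intervalIntegral.integral_interval_sub_left (h 0 u) (h 0 s)

lemma norm_curve_sub_le (hη : Continuous η) (s u : ℝ) :
    ‖curve η u - curve η s‖ ≤ |u - s| := by
  rw [curve_sub hη]
  simpa using intervalIntegral.norm_integral_le_of_norm_le_const (a := s) (b := u)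
    (f := tangent η) (C := 1) fun x _ => (norm_tangent x).le

lemma isCompact_trace (hη : Continuous η) (L : ℝ) : IsCompact (trace η L) :=
  isCompact_Icc.image (continuous_curve hη)

lemma continuousOn_cauchy_integrand (hη : Continuous η) {S : Set ℝ} {p : ℂ}
    (hp : ∀ s ∈ S, curve η s ≠ p) :
    ContinuousOn (fun s => tangent η s / (curve η s - p)) S :=
  (continuous_tangent hη).continuousOn.div
    ((continuous_curve hη).continuousOn.sub continuousOn_const)
    fun s hs => sub_ne_zero.2 (hp s hs)

lemma continuousAt_cauchy (hη : Continuous η) {a b : ℝ} (hab : a ≤ b) {p : ℂ}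
    (hp : ∀ s ∈ Icc a b, curve η s ≠ p) : ContinuousAt (cauchy η a b) p := by
  have hK : IsCompact (curve η '' Icc a b) := isCompact_Icc.image (continuous_curve hη)
  have hpK : p ∈ (curve η '' Icc a b)ᶜ := by
    rintro ⟨s, hs, h⟩; exact hp s hs h
  obtain ⟨d, hd, hdK⟩ := Metric.isOpen_iff.1 hK.isClosed.isOpen_compl p hpK
  have key : ∀ q ∈ ball p (d / 2), ∀ s ∈ Icc a b, d / 2 ≤ ‖curve η s - q‖ := by
    intro q hq s hs
    by_contra! h
    refine hdK (a := curve η s) ?_ ⟨s, hs, rfl⟩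
    rw [mem_ball, dist_eq_norm] at hq ⊢
    calc ‖curve η s - p‖ = ‖(curve η s - q) + (q - p)‖ := by congr 1; ring
      _ ≤ _ := norm_add_le _ _
      _ < d := by linarith
  have hev : ball p (d / 2) ∈ 𝓝 p := ball_mem_nhds _ (by positivity)
  refine intervalIntegral.continuousAt_of_dominated_interval (bound := fun _ => (d / 2)⁻¹)
    ?_ ?_ (by simp) ?_
  · filter_upwards [hev] with q hq
    rw [uIoc_of_le hab]
    refine ((continuousOn_cauchy_integrand hη (S := Icc a b) fun s hs h => ?_).mono
      Ioc_subset_Icc_self).aestronglyMeasurable measurableSet_Ioc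
    have := key q hq s hs
    rw [h] at this; simp at this; linarith
  · filter_upwards [hev] with q hq
    refine ae_of_all _ fun s hs => ?_
    rw [uIoc_of_le hab] at hs
    rw [norm_div, norm_tangent, one_div]
    exact inv_anti₀ (by positivity) (key q hq s (Ioc_subset_Icc_self hs))
  · refine ae_of_all _ fun s hs => ?_
    rw [uIoc_of_le hab] at hs
    exact continuousAt_const.div (continuousAt_const.sub continuousAt_id)
      (sub_ne_zero.2 (hp s (Ioc_subset_Icc_self hs)))

lemma not_mem_trace_iff {L : ℝ} {p : ℂ} :
    p ∉ trace η L ↔ ∀ s ∈ Icc 0 L, curve η s ≠ p := by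
  simp [trace]

lemma continuousOn_winding (hη : Continuous η) {L : ℝ} (hL : 0 ≤ L) :
    ContinuousOn (winding η L) (trace η L)ᶜ := fun _ hp =>
  ((Complex.continuous_im.continuousAt.comp
    (continuousAt_cauchy hη hL (not_mem_trace_iff.1 hp))).div_const _).continuousWithinAt

lemma exp_cauchy (hη : Continuous η) {L : ℝ} (hL : 0 ≤ L) (hc : curve η L = 0) {p : ℂ}
    (hp : p ∉ trace η L) : Complex.exp (cauchy η 0 L p) = 1 := by
  rw [not_mem_trace_iff] at hp
  have hcont : ContinuousOn (fun s => tangent η s / (curve η s - p)) (Icc 0 L) :=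
    continuousOn_cauchy_integrand hη hp
  set f : ℝ → ℂ := fun s => Complex.exp (-cauchy η 0 s p) * (curve η s - p) with hf
  have hcc : ContinuousOn (fun s => cauchy η 0 s p) (Icc 0 L) := by
    have := intervalIntegral.continuousOn_primitive_interval (μ := volume) (a := 0) (b := L)
      (f := fun s => tangent η s / (curve η s - p))
      (by rw [uIcc_of_le hL]; exact hcont.integrableOn_Icc)
    rwa [uIcc_of_le hL] at this
  have hfc : ContinuousOn f (Icc 0 L) :=
    (Complex.continuous_exp.comp_continuousOn hcc.neg).mul
      ((continuous_curve hη).continuousOn.sub continuousOn_const)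
  have hd : ∀ s ∈ Ico 0 L, HasDerivWithinAt f 0 (Ici s) s := by
    intro s hs
    have hs' : s ∈ Icc 0 L := Ico_subset_Icc_self hs
    have h1 : HasDerivWithinAt (fun s => cauchy η 0 s p)
        (tangent η s / (curve η s - p)) (Ici s) s := by
      have hcs : ContinuousAt (fun s => tangent η s / (curve η s - p)) s :=
        (continuous_tangent hη).continuousAt.div
          ((continuous_curve hη).continuousAt.sub continuousAt_const)
          (sub_ne_zero.2 (hp s hs'))
      refine (intervalIntegral.integral_hasDerivAt_right ?_ ?_ hcs).hasDerivWithinAt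
      · refine ContinuousOn.intervalIntegrable ?_
        rw [uIcc_of_le hs.1]
        exact hcont.mono (Icc_subset_Icc_right hs.2.le)
      · have : Measurable (fun s => tangent η s / (curve η s - p)) :=
          (continuous_tangent hη).measurable.div
            ((continuous_curve hη).measurable.sub_const p)
        exact this.stronglyMeasurable.stronglyMeasurableAtFilter
    have h2 := (h1.neg.cexp).mul ((hasDerivAt_curve hη s).hasDerivWithinAt.sub_const p)
    refine h2.congr_deriv ?_
    rw [mul_assoc, neg_mul, div_mul_cancel₀ _ (sub_ne_zero.2 (hp s hs'))]
    ring
  have hconst := constant_of_has_deriv_right_zero hfc hd L ⟨hL, le_rfl⟩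
  have h0 : curve η 0 = 0 := by simp [curve]
  have hp0 : p ≠ 0 := fun h => hp 0 ⟨le_rfl, hL⟩ (by rw [h0, h])
  simp only [hf, hc, h0] at hconst
  have : cauchy η 0 0 p = 0 := by simp [cauchy]
  rw [this] at hconst
  have h3 : Complex.exp (-cauchy η 0 L p) = 1 := by
    have h4 : (0 - p) ≠ 0 := by simpa using hp0
    refine mul_right_cancel₀ h4 ?_
    simpa using hconst
  rw [Complex.exp_neg, inv_eq_one] at h3
  exact h3

lemma exists_cauchy_eq (hη : Continuous η) {L : ℝ} (hL : 0 ≤ L) (hc : curve η L = 0) {p : ℂ}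
    (hp : p ∉ trace η L) :
    ∃ n : ℤ, winding η L p = n ∧ cauchy η 0 L p = n * (2 * Real.pi * Complex.I) := by
  obtain ⟨n, hn⟩ := Complex.exp_eq_one_iff.1 (exp_cauchy hη hL hc hp)
  refine ⟨n, ?_, hn⟩
  rw [winding, hn]
  have := Real.pi_pos
  simp [this.ne']

lemma isDiscrete_range_intCast : IsDiscrete (range ((↑) : ℤ → ℝ)) :=
  isDiscrete_iff_discreteTopology.2
    Int.isClosedEmbedding_coe_real.isEmbedding.toHomeomorph.symm.isEmbedding.discreteTopology

lemma winding_eq_of_isPreconnected (hη : Continuous η) {L : ℝ} (hL : 0 ≤ L)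
    (hc : curve η L = 0) {S : Set ℂ} (hS : IsPreconnected S) (hSt : S ⊆ (trace η L)ᶜ) {p q : ℂ}
    (hp : p ∈ S) (hq : q ∈ S) : winding η L p = winding η L q := by
  refine hS.constant_of_mapsTo isDiscrete_range_intCast
    ((continuousOn_winding hη hL).mono hSt) (fun x hx => ?_) hp hq
  obtain ⟨n, hn, -⟩ := exists_cauchy_eq hη hL hc (hSt hx)
  exact ⟨n, hn.symm⟩

lemma eventually_winding_eq (hη : Continuous η) {L : ℝ} (hL : 0 ≤ L)
    (hc : curve η L = 0) {p : ℂ} (hp : p ∉ trace η L) :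
    ∀ᶠ q in 𝓝 p, q ∉ trace η L ∧ winding η L q = winding η L p := by
  obtain ⟨d, hd, hdK⟩ :=
    Metric.isOpen_iff.1 (isCompact_trace hη L).isClosed.isOpen_compl p hp
  filter_upwards [ball_mem_nhds p hd] with q hq
  exact ⟨hdK hq, winding_eq_of_isPreconnected hη hL hc (convex_ball p d).isPreconnected hdK hq
    (mem_ball_self hd)⟩

lemma curve_zero : curve η 0 = 0 := by simp [curve]

lemma curve_ne_curve {L : ℝ} (hc : curve η L = 0) (hinj : InjOn (curve η) (Ico 0 L)) {s u : ℝ}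
    (hs : s ∈ Ioo 0 L) (hu : u ∈ Icc 0 L) (hne : u ≠ s) : curve η u ≠ curve η s := by
  have hs' : s ∈ Ico 0 L := Ioo_subset_Ico_self hs
  intro h
  rcases hu.2.lt_or_eq with hlt | rfl
  · exact hne (hinj ⟨hu.1, hlt⟩ hs' h)
  · rw [hc, ← curve_zero (η := η)] at h
    exact hs.1.ne (hinj ⟨le_rfl, hs.1.trans hs.2⟩ hs' h)

lemma exists_dist_lt_of_curve_near (hη : Continuous η) {L : ℝ} (hc : curve η L = 0)
    (hinj : InjOn (curve η) (Ico 0 L)) {s : ℝ} (hs : s ∈ Ioo 0 L) {ε : ℝ} (hε : 0 < ε) :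
    ∃ m > 0, ∀ u ∈ Icc 0 L, ‖curve η u - curve η s‖ < m → |u - s| < ε := by
  have hK : IsCompact (curve η '' (Icc 0 L \ ball s ε)) :=
    (isCompact_Icc.diff isOpen_ball).image (continuous_curve hη)
  have hmem : curve η s ∈ (curve η '' (Icc 0 L \ ball s ε))ᶜ := by
    rintro ⟨u, ⟨hu, hus⟩, h⟩
    refine curve_ne_curve hc hinj hs hu ?_ h
    rintro rfl
    exact hus (mem_ball_self hε)
  obtain ⟨m, hm, hmK⟩ := Metric.isOpen_iff.1 hK.isClosed.isOpen_compl _ hmem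
  refine ⟨m, hm, fun u hu hd => ?_⟩
  by_contra h
  exact hmK (mem_ball_iff_norm.2 hd) ⟨u, ⟨hu, fun h' => h (by simpa [Real.dist_eq] using h')⟩, rfl⟩

lemma re_tangent_div (s v : ℝ) : (tangent η v / tangent η s).re = Real.cos (η v - η s) := by
  rw [tangent, tangent, ← Complex.exp_sub, ← sub_mul, ← Complex.ofReal_sub,
    Complex.exp_ofReal_mul_I_re, ← Real.cos_neg]
  congr 1; ring

lemma re_curve_sub_div_pos (hη : Continuous η) {a b s : ℝ} (hab : a < b)
    (h : ∀ v ∈ Icc a b, 0 < Real.cos (η v - η s)) :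
    0 < ((curve η b - curve η a) / tangent η s).re := by
  rw [curve_sub hη, ← intervalIntegral.integral_div]
  have hi : IntervalIntegrable (fun v => tangent η v / tangent η s) volume a b :=
    ((continuous_tangent hη).div_const _).intervalIntegrable a b
  have := Complex.reCLM.intervalIntegral_comp_comm hi
  simp only [Complex.reCLM_apply] at this
  rw [← this]
  simp only [re_tangent_div]
  refine intervalIntegral.intervalIntegral_pos_of_pos_on
    (Continuous.intervalIntegrable (by fun_prop) _ _)
    (fun v hv => h v (Ioo_subset_Icc_self hv)) hab

lemma exists_cos_pos (hη : Continuous η) {L s : ℝ} (hs : s ∈ Ioo 0 L) :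
    ∃ ε > 0, 0 < s - ε ∧ s + ε < L ∧
      ∀ u v, |u - s| ≤ ε → |v - s| ≤ ε → 0 < Real.cos (η u - η v) := by
  obtain ⟨d, hd, h⟩ := Metric.continuousAt_iff.1 hη.continuousAt (Real.pi / 4)
    (by positivity)
  have hs1 := hs.1
  have hs2 := hs.2
  refine ⟨min (d / 2) (min (s / 2) ((L - s) / 2)), by
    refine lt_min (by positivity) (lt_min (by positivity) (by linarith)), ?_, ?_, ?_⟩
  · have := (min_le_right (d / 2) (min (s / 2) ((L - s) / 2))).trans (min_le_left _ _)
    linarith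
  · have := (min_le_right (d / 2) (min (s / 2) ((L - s) / 2))).trans (min_le_right _ _)
    linarith
  · intro u v hu hv
    have hm := min_le_left (d / 2) (min (s / 2) ((L - s) / 2))
    have h1 := h (x := u) (by rw [Real.dist_eq]; linarith)
    have h2 := h (x := v) (by rw [Real.dist_eq]; linarith)
    rw [Real.dist_eq, abs_lt] at h1 h2
    exact Real.cos_pos_of_mem_Ioo ⟨by linarith [h1.1, h2.2], by linarith [h1.2, h2.1]⟩

lemma re_curve_sub_div_ne_zero (hη : Continuous η) {s₀ ε s u v : ℝ}
    (hcos : ∀ u v, |u - s₀| ≤ ε → |v - s₀| ≤ ε → 0 < Real.cos (η u - η v))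
    (hs : |s - s₀| ≤ ε) (hu : |u - s₀| ≤ ε) (hv : |v - s₀| ≤ ε) (hsu : u ≠ s) :
    ((curve η u - curve η s) / tangent η v).re ≠ 0 := by
  rw [abs_le] at hs hu
  rcases lt_or_gt_of_ne hsu with h | h
  · have := re_curve_sub_div_pos hη h (s := v) fun x hx =>
      hcos x v (abs_le.2 ⟨by linarith [hx.1], by linarith [hx.2]⟩) hv
    rw [← neg_sub, neg_div, Complex.neg_re]
    linarith
  · exact (re_curve_sub_div_pos hη h (s := v) fun x hx =>
      hcos x v (abs_le.2 ⟨by linarith [hx.1], by linarith [hx.2]⟩) hv).ne'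

/-- The point at signed distance `t` from `curve η s` along the normal. -/
noncomputable def offset (η : ℝ → ℝ) (s t : ℝ) : ℂ := curve η s + t * Complex.I * tangent η s

lemma continuous_offset (hη : Continuous η) : Continuous fun x : ℝ × ℝ => offset η x.1 x.2 := by
  have h1 := continuous_curve hη
  have h2 := continuous_tangent hη
  unfold offset
  fun_prop

lemma exists_offset_notMem (hη : Continuous η) {L : ℝ} (hc : curve η L = 0)
    (hinj : InjOn (curve η) (Ico 0 L)) {s₀ : ℝ} (hs₀ : s₀ ∈ Ioo 0 L) :
    ∃ δ > 0, ∀ s t, |s - s₀| < δ → |t| < δ → t ≠ 0 → offset η s t ∉ trace η L := by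
  obtain ⟨ε, hε, h0, h1, hcos⟩ := exists_cos_pos hη hs₀
  obtain ⟨m, hm, hsep⟩ := exists_dist_lt_of_curve_near hη hc hinj hs₀ hε
  refine ⟨min ε (m / 2), lt_min hε (by positivity), ?_⟩
  rintro s t hs ht ht0 ⟨u, hu, h⟩
  have hsε := hs.trans_le (min_le_left _ _)
  have hsm := hs.trans_le (min_le_right _ _)
  have htm := ht.trans_le (min_le_right _ _)
  have huε : |u - s₀| < ε := by
    refine hsep u hu ?_
    rw [h, offset]
    calc ‖curve η s + t * Complex.I * tangent η s - curve η s₀‖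
        = ‖(curve η s - curve η s₀) + t * Complex.I * tangent η s‖ := by congr 1; ring
      _ ≤ ‖curve η s - curve η s₀‖ + ‖t * Complex.I * tangent η s‖ := norm_add_le _ _
      _ ≤ |s - s₀| + |t| := by
        gcongr
        · exact norm_curve_sub_le hη _ _
        · simp [norm_tangent]
      _ < m := by linarith
  have hquot : (curve η u - curve η s) / tangent η s = t * Complex.I := by
    rw [h, offset, add_sub_cancel_left, mul_div_cancel_right₀ _ (tangent_ne_zero s)]
  by_cases hus : u = s
  · rw [hus] at hquot
    simp [ht0] at hquot
  · refine re_curve_sub_div_ne_zero hη hcos hsε.le huε.le hsε.le hus ?_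
    rw [hquot]; simp

lemma re_div_tangent (z : ℂ) (s : ℝ) : (z / tangent η s).re = inner ℝ z (tangent η s) := by
  rw [Complex.inner, Complex.div_re, Complex.normSq_eq_norm_sq, norm_tangent]
  simp
  ring

lemma exists_eq_offset (hη : Continuous η) {L : ℝ} (hc : curve η L = 0)
    (hinj : InjOn (curve η) (Ico 0 L)) {s₀ δ : ℝ} (hs₀ : s₀ ∈ Ioo 0 L) (hδ : 0 < δ) :
    ∀ᶠ p in 𝓝 (curve η s₀), p ∉ trace η L →
      ∃ s t, |s - s₀| < δ ∧ |t| < δ ∧ t ≠ 0 ∧ p = offset η s t := by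
  obtain ⟨ε, hε, h0, h1, -⟩ := exists_cos_pos hη hs₀
  obtain ⟨m, hm, hsep⟩ := exists_dist_lt_of_curve_near hη hc hinj hs₀ (lt_min hε hδ)
  filter_upwards [ball_mem_nhds (curve η s₀) (lt_min (half_pos hm) hδ)] with p hp hpt
  rw [mem_ball_iff_norm, ← norm_neg, neg_sub] at hp
  have hcont : Continuous fun u => ‖curve η u - p‖ ^ 2 := by
    have := continuous_curve hη
    fun_prop
  obtain ⟨s, hs, hmin⟩ := isCompact_Icc.exists_isMinOn (s := Icc 0 L)
    ⟨s₀, Ioo_subset_Icc_self hs₀⟩ hcont.continuousOn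
  have hle : ‖curve η s - p‖ ≤ ‖curve η s₀ - p‖ :=
    le_of_sq_le_sq (hmin (Ioo_subset_Icc_self hs₀)) (norm_nonneg _)
  have hs' : |s - s₀| < min ε δ := by
    refine hsep s hs ?_
    calc ‖curve η s - curve η s₀‖ = ‖(curve η s - p) - (curve η s₀ - p)‖ := by congr 1; ring
      _ ≤ ‖curve η s - p‖ + ‖curve η s₀ - p‖ := norm_sub_le _ _
      _ < m := by linarith [hp.trans_le (min_le_left _ _)]
  have hsε := abs_lt.1 (hs'.trans_le (min_le_left _ _))
  have hloc : IsLocalMin (fun u => ‖curve η u - p‖ ^ 2) s :=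
    hmin.isLocalMin (Icc_mem_nhds (by linarith) (by linarith))
  have hzero := hloc.hasDerivAt_eq_zero ((hasDerivAt_curve hη s).sub_const p).norm_sq
  have hre : ((curve η s - p) / tangent η s).re = 0 := by
    rw [re_div_tangent]; linarith
  set t := ((p - curve η s) / tangent η s).im with ht
  have hz : (p - curve η s) / tangent η s = t * Complex.I := by
    apply Complex.ext
    · rw [← neg_sub, neg_div, Complex.neg_re, hre]; simp
    · simp [ht]
  have hpe : p - curve η s = t * Complex.I * tangent η s := by
    rw [← hz, div_mul_cancel₀ _ (tangent_ne_zero s)]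
  refine ⟨s, t, hs'.trans_le (min_le_right _ _), ?_, ?_, ?_⟩
  · calc |t| = ‖p - curve η s‖ := by rw [hpe]; simp [norm_tangent]
      _ = ‖curve η s - p‖ := norm_sub_rev _ _
      _ < δ := hle.trans_lt (hp.trans_le (min_le_right _ _))
  · intro h
    rw [h] at hpe
    exact hpt ⟨s, hs, (sub_eq_zero.1 (by simpa using hpe)).symm⟩
  · rw [offset, ← hpe]; ring

lemma cauchy_eq_log_sub (hη : Continuous η) {a b : ℝ} (hab : a ≤ b) {p c : ℂ} (hc : c ≠ 0)
    (h : ∀ u ∈ Icc a b, c * (curve η u - p) ∈ Complex.slitPlane) :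
    cauchy η a b p =
      Complex.log (c * (curve η b - p)) - Complex.log (c * (curve η a - p)) := by
  refine intervalIntegral.integral_eq_sub_of_hasDerivAt
    (f := fun u => Complex.log (c * (curve η u - p))) ?_ ?_
  · intro u hu
    rw [uIcc_of_le hab] at hu
    have h1 := (((hasDerivAt_curve hη u).sub_const p).const_mul c).clog_real (h u hu)
    refine h1.congr_deriv ?_
    exact mul_div_mul_left _ _ hc
  · refine ContinuousOn.intervalIntegrable ?_
    rw [uIcc_of_le hab]
    refine continuousOn_cauchy_integrand hη fun s hs h' => ?_
    have := h s hs
    rw [h'] at this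
    simp at this

lemma cauchy_eq_add (hη : Continuous η) {L a b : ℝ} (ha : 0 ≤ a) (hab : a ≤ b) (hb : b ≤ L)
    {p : ℂ} (hp : p ∉ trace η L) :
    cauchy η 0 L p = cauchy η 0 a p + cauchy η a b p + cauchy η b L p := by
  have hint : ∀ x ∈ Icc 0 L, ∀ y ∈ Icc 0 L,
      IntervalIntegrable (fun s => tangent η s / (curve η s - p)) volume x y := by
    intro x hx y hy
    exact (continuousOn_cauchy_integrand hη fun s hs =>
      not_mem_trace_iff.1 hp s (uIcc_subset_Icc hx hy hs)).intervalIntegrable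
  have h0 : (0 : ℝ) ∈ Icc 0 L := ⟨le_rfl, ha.trans (hab.trans hb)⟩
  have hA : a ∈ Icc 0 L := ⟨ha, hab.trans hb⟩
  have hB : b ∈ Icc 0 L := ⟨ha.trans hab, hb⟩
  have hL : L ∈ Icc 0 L := ⟨h0.2, le_rfl⟩
  unfold cauchy
  rw [intervalIntegral.integral_add_adjacent_intervals (hint 0 h0 a hA) (hint a hA b hB),
    intervalIntegral.integral_add_adjacent_intervals (hint 0 h0 b hB) (hint b hB L hL)]

lemma tendsto_offset (hη : Continuous η) (s : ℝ) :
    Tendsto (offset η s) (𝓝[>] 0) (𝓝 (curve η s)) := by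
  have h : Continuous (offset η s) := (continuous_offset hη).comp (Continuous.prodMk_right s)
  have := (h.tendsto 0).mono_left (nhdsWithin_le_nhds (s := Ioi 0))
  simpa [offset] using this

lemma tendsto_offset_neg (hη : Continuous η) (s : ℝ) :
    Tendsto (fun t => offset η s (-t)) (𝓝[>] 0) (𝓝 (curve η s)) := by
  have h : Continuous (fun t => offset η s (-t)) :=
    ((continuous_offset hη).comp (Continuous.prodMk_right s)).comp continuous_neg
  have := (h.tendsto 0).mono_left (nhdsWithin_le_nhds (s := Ioi 0))
  simpa [offset] using this

/-- Crossing the curve from right to left raises the winding number by one. -/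
lemma tendsto_winding_jump (hη : Continuous η) {L : ℝ} (hc : curve η L = 0)
    (hinj : InjOn (curve η) (Ico 0 L)) {s₀ : ℝ} (hs₀ : s₀ ∈ Ioo 0 L) :
    Tendsto (fun t => winding η L (offset η s₀ t) - winding η L (offset η s₀ (-t)))
      (𝓝[>] 0) (𝓝 1) := by
  obtain ⟨ε, hε, h0, h1, hcos⟩ := exists_cos_pos hη hs₀
  obtain ⟨δ, hδ, hoff⟩ := exists_offset_notMem hη hc hinj hs₀
  set a := s₀ - ε with ha
  set b := s₀ + ε with hb
  have hab : a ≤ b := by linarith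
  set g : ℝ → ℂ := fun u => (curve η u - curve η s₀) / tangent η s₀ with hg
  have hself : |s₀ - s₀| ≤ ε := by simpa using hε.le
  have hga : (g a).re < 0 := by
    have := re_curve_sub_div_pos hη (a := a) (b := s₀) (s := s₀) (by linarith) fun x hx =>
      hcos x s₀ (abs_le.2 ⟨by linarith [hx.1], by linarith [hx.2]⟩) hself
    simp only [hg]
    rw [← neg_sub, neg_div, Complex.neg_re]
    linarith
  have hgb : 0 < (g b).re :=
    re_curve_sub_div_pos hη (a := s₀) (b := b) (s := s₀) (by linarith) fun x hx =>
      hcos x s₀ (abs_le.2 ⟨by linarith [hx.1], by linarith [hx.2]⟩) hself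
  have hslit : ∀ u ∈ Icc a b, ∀ t : ℝ, 0 < t → Complex.I * g u + t ∈ Complex.slitPlane ∧
      -(Complex.I * g u) + t ∈ Complex.slitPlane := by
    intro u hu t ht
    by_cases hus : u = s₀
    · have : g u = 0 := by simp [hg, hus]
      rw [this]
      simp [Complex.mem_slitPlane_iff, ht]
    · have : (g u).re ≠ 0 := re_curve_sub_div_ne_zero hη hcos hself
        (abs_le.2 ⟨by linarith [hu.1], by linarith [hu.2]⟩) hself hus
      simp [Complex.mem_slitPlane_iff, this]
  have hT := tangent_ne_zero (η := η) s₀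
  have hpos : ∀ u (t : ℝ), Complex.I / tangent η s₀ * (curve η u - offset η s₀ t) =
      Complex.I * g u + t := by
    intro u t
    simp only [hg, offset]
    field_simp
    ring_nf
    simp
  have hneg : ∀ u (t : ℝ), -Complex.I / tangent η s₀ * (curve η u - offset η s₀ (-t)) =
      -(Complex.I * g u) + t := by
    intro u t
    have := hpos u (-t)
    rw [neg_div, neg_mul, this]
    push_cast
    ring
  set N : ℝ → ℝ := fun t => (Complex.arg (Complex.I * g b + t) - Complex.arg (Complex.I * g a + t))
    - (Complex.arg (-(Complex.I * g b) + t) - Complex.arg (-(Complex.I * g a) + t)) with hN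
  have hnear : ∀ t : ℝ, 0 < t → (cauchy η a b (offset η s₀ t)).im
      - (cauchy η a b (offset η s₀ (-t))).im = N t := by
    intro t ht
    rw [cauchy_eq_log_sub hη hab (c := Complex.I / tangent η s₀) (by simp [hT])
        (fun u hu => by rw [hpos]; exact (hslit u hu t ht).1),
      cauchy_eq_log_sub hη hab (c := -Complex.I / tangent η s₀) (by simp [hT])
        (fun u hu => by rw [hneg]; exact (hslit u hu t ht).2)]
    simp only [hpos, hneg, Complex.sub_im, Complex.log_im, hN]
  have hNlim : Tendsto N (𝓝[>] 0) (𝓝 (2 * Real.pi)) := by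
    have harg : ∀ z : ℂ, z.im ≠ 0 →
        Tendsto (fun t : ℝ => Complex.arg (z + t)) (𝓝[>] 0) (𝓝 (Complex.arg z)) := by
      intro z hz
      have h2 : Tendsto (fun t : ℝ => z + t) (𝓝[>] 0) (𝓝 z) := by
        have h3 : Continuous (fun t : ℝ => z + t) := by fun_prop
        simpa using (h3.tendsto 0).mono_left (nhdsWithin_le_nhds (s := Ioi 0))
      exact (Complex.continuousAt_arg (Or.inr hz)).tendsto.comp h2
    have hb' : (Complex.I * g b).im ≠ 0 := by simpa using hgb.ne'
    have ha' : (Complex.I * g a).im ≠ 0 := by simpa using hga.ne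
    have := ((harg _ hb').sub (harg _ ha')).sub
      ((harg (-(Complex.I * g b)) (by simpa using hgb.ne')).sub
        (harg (-(Complex.I * g a)) (by simpa using hga.ne)))
    rw [Complex.arg_neg_eq_arg_sub_pi_of_im_pos (by simpa using hgb),
      Complex.arg_neg_eq_arg_add_pi_of_im_neg (by simpa using hga)] at this
    convert this using 2
    ring
  have hfar : ∀ x y : ℝ, x ≤ y → Icc x y ⊆ Icc 0 L → s₀ ∉ Icc x y →
      Tendsto (fun t => (cauchy η x y (offset η s₀ t)).im - (cauchy η x y (offset η s₀ (-t))).im)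
        (𝓝[>] 0) (𝓝 0) := by
    intro x y hxy hsub hnot
    have hcts : ContinuousAt (fun p => (cauchy η x y p).im) (curve η s₀) :=
      Complex.continuous_im.continuousAt.comp (continuousAt_cauchy hη hxy fun s hs =>
        curve_ne_curve hc hinj hs₀ (hsub hs) fun h => hnot (h ▸ hs))
    simpa using (hcts.tendsto.comp (tendsto_offset hη s₀)).sub
      (hcts.tendsto.comp (tendsto_offset_neg hη s₀))
  have h2 := hfar 0 a h0.le (Icc_subset_Icc_right (by linarith)) (fun h => by linarith [h.2])
  have h3 := hfar b L h1.le (Icc_subset_Icc_left (by linarith)) (fun h => by linarith [h.1])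
  have hlim := ((h2.add hNlim).add h3).div_const (2 * Real.pi)
  have hone : (0 + 2 * Real.pi + 0) / (2 * Real.pi) = 1 := by
    have := Real.pi_pos
    field_simp
    ring
  rw [hone] at hlim
  refine hlim.congr' ?_
  filter_upwards [Ioo_mem_nhdsGT hδ] with t ht
  have ht1 := hoff s₀ t (by simpa using hδ) (abs_lt.2 ⟨by linarith [ht.1], ht.2⟩) ht.1.ne'
  have ht2 := hoff s₀ (-t) (by simpa using hδ)
    (abs_lt.2 ⟨by linarith [ht.2], by linarith [ht.1]⟩) (by linarith [ht.1])
  rw [winding, winding, cauchy_eq_add hη h0.le hab h1.le ht1,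
    cauchy_eq_add hη h0.le hab h1.le ht2, ← hnear t ht.1]
  simp only [Complex.add_im]
  ring

/-- Near `curve η s` the winding number takes exactly the values `k` and `k + 1`. -/
def JumpsFrom (η : ℝ → ℝ) (L s : ℝ) (k : ℤ) : Prop :=
  (∀ᶠ p in 𝓝 (curve η s), p ∉ trace η L → winding η L p = k ∨ winding η L p = k + 1) ∧
  (∃ᶠ p in 𝓝 (curve η s), p ∉ trace η L ∧ winding η L p = k) ∧
  ∃ᶠ p in 𝓝 (curve η s), p ∉ trace η L ∧ winding η L p = k + 1

lemma exists_jumpsFrom (hη : Continuous η) {L : ℝ} (hL : 0 ≤ L) (hc : curve η L = 0)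
    (hinj : InjOn (curve η) (Ico 0 L)) {s₀ : ℝ} (hs₀ : s₀ ∈ Ioo 0 L) :
    ∃ k, JumpsFrom η L s₀ k := by
  obtain ⟨δ, hδ, hoff⟩ := exists_offset_notMem hη hc hinj hs₀
  have hside : ∀ T : Set ℝ, Convex ℝ T → (∀ t ∈ T, |t| < δ ∧ t ≠ 0) →
      ∀ s ∈ ball s₀ δ, ∀ t ∈ T, ∀ t' ∈ T,
        winding η L (offset η s t) = winding η L (offset η s₀ t') := by
    intro T hT hTδ s hs t ht t' ht'
    have hpre : IsPreconnected ((fun x : ℝ × ℝ => offset η x.1 x.2) '' (ball s₀ δ ×ˢ T)) :=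
      (((convex_ball s₀ δ).isPreconnected).prod hT.isPreconnected).image _
        (continuous_offset hη).continuousOn
    refine winding_eq_of_isPreconnected hη hL hc hpre ?_ ⟨(s, t), ⟨hs, ht⟩, rfl⟩
      ⟨(s₀, t'), ⟨mem_ball_self hδ, ht'⟩, rfl⟩
    rintro _ ⟨⟨x, y⟩, ⟨hx, hy⟩, rfl⟩
    exact hoff x y (by simpa [Real.dist_eq] using hx) (hTδ y hy).1 (hTδ y hy).2
  have hpos := hside (Ioo 0 δ) (convex_Ioo _ _) fun t ht =>
    ⟨abs_lt.2 ⟨by linarith [ht.1], ht.2⟩, ht.1.ne'⟩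
  have hneg := hside (Ioo (-δ) 0) (convex_Ioo _ _) fun t ht =>
    ⟨abs_lt.2 ⟨ht.1, by linarith [ht.2]⟩, ht.2.ne⟩
  have hδ2 : δ / 2 ∈ Ioo 0 δ := ⟨by linarith, by linarith⟩
  have hδ2' : -(δ / 2) ∈ Ioo (-δ) 0 := ⟨by linarith, by linarith⟩
  obtain ⟨k, hk, -⟩ := exists_cauchy_eq hη hL hc
    (hoff s₀ (-(δ / 2)) (by simpa using hδ) (abs_lt.2 ⟨by linarith, by linarith⟩) (by linarith))
  have hev : ∀ᶠ t in 𝓝[>] (0 : ℝ), t ∈ Ioo 0 δ := Ioo_mem_nhdsGT hδ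
  have hjump : winding η L (offset η s₀ (δ / 2)) = k + 1 := by
    have h1 : Tendsto (fun _ : ℝ => winding η L (offset η s₀ (δ / 2)) - k) (𝓝[>] 0) (𝓝 1) := by
      refine (tendsto_winding_jump hη hc hinj hs₀).congr' ?_
      filter_upwards [hev] with t ht
      rw [hpos s₀ (mem_ball_self hδ) t ht _ hδ2,
        hneg s₀ (mem_ball_self hδ) (-t) ⟨by linarith [ht.2], by linarith [ht.1]⟩ _ hδ2', hk]
    have := tendsto_nhds_unique tendsto_const_nhds h1
    linarith
  refine ⟨k, ?_, ?_, ?_⟩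
  · filter_upwards [exists_eq_offset hη hc hinj hs₀ hδ] with p hp hpt
    obtain ⟨s, t, hs, ht, ht0, rfl⟩ := hp hpt
    have hs' : s ∈ ball s₀ δ := by simpa [Real.dist_eq] using hs
    rw [abs_lt] at ht
    rcases lt_or_gt_of_ne ht0 with h | h
    · left; rw [hneg s hs' t ⟨ht.1, h⟩ _ hδ2', hk]
    · right; rw [hpos s hs' t ⟨h, ht.2⟩ _ hδ2, hjump]
  · refine (tendsto_offset_neg hη s₀).frequently (Eventually.frequently ?_)
    filter_upwards [hev] with t ht
    have ht' : -t ∈ Ioo (-δ) 0 := ⟨by linarith [ht.2], by linarith [ht.1]⟩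
    exact ⟨hoff s₀ _ (by simpa using hδ) (abs_lt.2 ⟨ht'.1, by linarith [ht'.2]⟩) ht'.2.ne,
      by rw [hneg s₀ (mem_ball_self hδ) _ ht' _ hδ2', hk]⟩
  · refine (tendsto_offset hη s₀).frequently (Eventually.frequently ?_)
    filter_upwards [hev] with t ht
    exact ⟨hoff s₀ _ (by simpa using hδ) (abs_lt.2 ⟨by linarith [ht.1], ht.2⟩) ht.1.ne',
      by rw [hpos s₀ (mem_ball_self hδ) _ ht _ hδ2, hjump]⟩

lemma eventually_jumpsFrom_unique (hη : Continuous η) {L s₀ : ℝ} {k : ℤ}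
    (hk : JumpsFrom η L s₀ k) : ∀ᶠ s in 𝓝 s₀, ∀ k', JumpsFrom η L s k' → k' = k := by
  have h := (continuous_curve hη).continuousAt.eventually (eventually_eventually_nhds.2 hk.1)
  filter_upwards [h] with s hs k' hk'
  obtain ⟨p, ⟨hp, hpk⟩, hp'⟩ := (hk'.2.1.and_eventually hs).exists
  obtain ⟨q, ⟨hq, hqk⟩, hq'⟩ := (hk'.2.2.and_eventually hs).exists
  have h1 := hp' hp
  have h2 := hq' hq
  rw [hpk] at h1
  rw [hqk] at h2
  norm_cast at h1 h2
  omega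

lemma exists_forall_jumpsFrom (hη : Continuous η) {L : ℝ} (hL : 0 < L) (hc : curve η L = 0)
    (hinj : InjOn (curve η) (Ico 0 L)) : ∃ k, ∀ s ∈ Ioo 0 L, JumpsFrom η L s k := by
  choose! κ hκ using fun s (hs : s ∈ Ioo 0 L) => exists_jumpsFrom hη hL.le hc hinj hs
  have hcont : ContinuousOn κ (Ioo 0 L) := by
    intro s hs
    refine ContinuousAt.continuousWithinAt (Tendsto.congr' (f₁ := fun _ => κ s) ?_
      tendsto_const_nhds)
    filter_upwards [eventually_jumpsFrom_unique hη (hκ s hs), isOpen_Ioo.mem_nhds hs] with u h hu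
    exact (h _ (hκ u hu)).symm
  have hmid : L / 2 ∈ Ioo 0 L := ⟨by linarith, by linarith⟩
  refine ⟨κ (L / 2), fun s hs => ?_⟩
  rw [isPreconnected_Ioo.constant hcont hmid hs]
  exact hκ s hs

lemma winding_eq_or_eq (hη : Continuous η) {L : ℝ} (hL : 0 < L) (hc : curve η L = 0)
    (hinj : InjOn (curve η) (Ico 0 L)) {k : ℤ}
    (hk : ∀ s ∈ Ioo 0 L, JumpsFrom η L s k) {p : ℂ} (hp : p ∉ trace η L) :
    winding η L p = k ∨ winding η L p = k + 1 := by
  by_contra hbad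
  set U : Set ℂ := {q | q ∉ trace η L ∧ ¬(winding η L q = k ∨ winding η L q = k + 1)} with hU
  have hopen : IsOpen U := by
    rw [isOpen_iff_mem_nhds]
    rintro q ⟨hq, hq'⟩
    filter_upwards [eventually_winding_eq hη hL.le hc hq] with r hr
    exact ⟨hr.1, by rwa [hr.2]⟩
  have h0 : (0 : ℂ) ∈ trace η L := ⟨0, ⟨le_rfl, hL.le⟩, curve_zero⟩
  have hsub : ({0}ᶜ : Set ℂ) ⊆ U := by
    refine (isConnected_compl_singleton_of_one_lt_rank
      (by simp) (0 : ℂ)).isPreconnected.subset_of_closure_inter_subset hopen ⟨p, ?_, hp, hbad⟩ ?_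
    · rintro rfl; exact hp h0
    · rintro q ⟨hq, hq0⟩
      rw [mem_closure_iff_frequently] at hq
      by_cases hqt : q ∈ trace η L
      · obtain ⟨s, hs, rfl⟩ := hqt
        have hs' : s ∈ Ioo 0 L := by
          refine ⟨hs.1.lt_of_ne ?_, hs.2.lt_of_ne ?_⟩
          · rintro rfl; exact hq0 curve_zero
          · rintro rfl; exact hq0 hc
        obtain ⟨r, hr, hr'⟩ := (hq.and_eventually (hk s hs').1).exists
        exact absurd (hr' hr.1) hr.2
      · obtain ⟨r, hr, hr'⟩ := (hq.and_eventually (eventually_winding_eq hη hL.le hc hqt)).exists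
        exact ⟨hqt, hr'.2 ▸ hr.2⟩
  have hmid : L / 2 ∈ Ioo 0 L := ⟨by linarith, by linarith⟩
  have hmid0 : curve η (L / 2) ≠ 0 := by
    rw [← curve_zero (η := η)]
    exact (curve_ne_curve hc hinj hmid ⟨le_rfl, hL.le⟩ hmid.1.ne).symm
  exact (hsub hmid0).1 ⟨_, Ioo_subset_Icc_self hmid, rfl⟩

lemma norm_curve_le (hη : Continuous η) {L s : ℝ} (hs : s ∈ Icc 0 L) : ‖curve η s‖ ≤ L := by
  have := norm_curve_sub_le hη 0 s
  rw [curve_zero, sub_zero, sub_zero, abs_of_nonneg hs.1] at this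
  exact this.trans hs.2

lemma exists_winding_eq_zero (hη : Continuous η) {L : ℝ} (hL : 0 < L) (hc : curve η L = 0) :
    ∃ p, p ∉ trace η L ∧ winding η L p = 0 := by
  have hfar : ∀ s ∈ Icc 0 L, L ≤ ‖curve η s - ((2 * L : ℝ) : ℂ)‖ := by
    intro s hs
    have h1 := norm_sub_norm_le ((2 * L : ℝ) : ℂ) (curve η s)
    rw [norm_sub_rev, Complex.norm_of_nonneg (by positivity)] at h1
    linarith [norm_curve_le hη hs]
  have hp : ((2 * L : ℝ) : ℂ) ∉ trace η L := by
    rintro ⟨s, hs, h⟩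
    have := hfar s hs
    rw [h, sub_self, norm_zero] at this
    linarith
  refine ⟨_, hp, ?_⟩
  obtain ⟨n, hn, hn'⟩ := exists_cauchy_eq hη hL.le hc hp
  have hle : ‖cauchy η 0 L ((2 * L : ℝ) : ℂ)‖ ≤ L⁻¹ * |L - 0| := by
    refine intervalIntegral.norm_integral_le_of_norm_le_const fun s hs => ?_
    rw [uIoc_of_le hL.le] at hs
    rw [norm_div, norm_tangent, one_div]
    exact inv_anti₀ hL (hfar s (Ioc_subset_Icc_self hs))
  rw [sub_zero, abs_of_pos hL, inv_mul_cancel₀ hL.ne', hn'] at hle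
  have hpi : |(n : ℝ)| * (2 * Real.pi) ≤ 1 := by
    simpa [abs_of_pos Real.pi_pos] using hle
  have h1 : |(n : ℝ)| < 1 := by
    nlinarith [Real.pi_gt_three, abs_nonneg (n : ℝ)]
  have h2 : n = 0 := by
    rw [← Int.abs_lt_one_iff]
    exact_mod_cast h1
  rw [hn, h2, Int.cast_zero]

lemma volume_trace (hη : Continuous η) (L : ℝ) : volume (trace η L) = 0 := by
  have hline : volume {z : ℂ | z.im = 0} = 0 := by
    have := Measure.addHaar_submodule (volume : Measure ℂ) (LinearMap.ker Complex.imLm) (by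
      intro h
      have : Complex.I ∈ LinearMap.ker Complex.imLm := h ▸ Submodule.mem_top
      simp at this)
    exact this
  refine measure_mono_null ?_ (addHaar_image_eq_zero_of_differentiableOn_of_addHaar_eq_zero volume
    (f := fun z : ℂ => curve η z.re) (fun z _ => ?_) hline)
  · rintro _ ⟨s, -, rfl⟩
    exact ⟨(s : ℂ), by simp, by simp⟩
  · exact ((hasDerivAt_curve hη z.re).differentiableAt.comp z
      Complex.reCLM.differentiableAt).differentiableWithinAt

lemma integrableOn_inv_ball (R : ℝ) : IntegrableOn (fun q : ℂ => q⁻¹) (ball 0 R) := by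
  refine integrableOn_ball_of_norm_le_rpow (C := 1) (α := 1) (by simp) (by simp) ?_
    measurable_inv.aestronglyMeasurable
  refine ae_of_all _ fun q => ?_
  rw [norm_inv, one_mul, Real.rpow_neg_one]

lemma integrable_translated_kernel (R : ℝ) (z : ℂ) :
    Integrable fun p => (ball (0 : ℂ) (R + R)).indicator (fun q => q⁻¹) (z - p) :=
  ((integrable_indicator_iff measurableSet_ball).2 (integrableOn_inv_ball (R + R))).comp_sub_left z

lemma translated_kernel_eq {R : ℝ} {z p : ℂ} (hz : ‖z‖ < R) (hp : p ∈ ball 0 R) :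
    (ball (0 : ℂ) (R + R)).indicator (fun q => q⁻¹) (z - p) = (z - p)⁻¹ := by
  refine indicator_of_mem ?_ _
  rw [mem_ball_zero_iff] at hp ⊢
  exact (norm_sub_le z p).trans_lt (add_lt_add hz hp)

lemma integrableOn_inv_sub_ball {R : ℝ} {z : ℂ} (hz : ‖z‖ < R) :
    IntegrableOn (fun p => (z - p)⁻¹) (ball 0 R) :=
  (integrable_translated_kernel R z).integrableOn.congr_fun
    (fun _ hp => translated_kernel_eq hz hp) measurableSet_ball

lemma integral_norm_inv_sub_ball_le {R : ℝ} {z : ℂ} (hz : ‖z‖ < R) :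
    ∫ p in ball 0 R, ‖(z - p)⁻¹‖ ≤ ∫ q in ball (0 : ℂ) (R + R), ‖q⁻¹‖ := by
  calc ∫ p in ball 0 R, ‖(z - p)⁻¹‖
      = ∫ p in ball 0 R, ‖(ball (0 : ℂ) (R + R)).indicator (fun q => q⁻¹) (z - p)‖ :=
        setIntegral_congr_fun measurableSet_ball fun p hp => by
          simp only [translated_kernel_eq hz hp]
    _ ≤ ∫ p, ‖(ball (0 : ℂ) (R + R)).indicator (fun q => q⁻¹) (z - p)‖ :=
        setIntegral_le_integral (integrable_translated_kernel R z).norm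
          (ae_of_all _ fun _ => norm_nonneg _)
    _ = ∫ q, ‖(ball (0 : ℂ) (R + R)).indicator (fun q => q⁻¹) q‖ :=
        integral_sub_left_eq_self (fun q => ‖(ball (0 : ℂ) (R + R)).indicator (fun q => q⁻¹) q‖) _ z
    _ = ∫ q in ball (0 : ℂ) (R + R), ‖q⁻¹‖ := by
        simp only [norm_indicator_eq_indicator_norm]
        exact integral_indicator measurableSet_ball

lemma circleAverage_inv_sub_of_lt {z : ℂ} {r : ℝ} (hr : 0 < r) (hz : r < ‖z‖) :
    Real.circleAverage (fun p => (z - p)⁻¹) 0 r = z⁻¹ := by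
  have hne : ∀ p ∈ closedBall (0 : ℂ) |r|, z - p ≠ 0 := by
    intro p hp h
    rw [mem_closedBall_zero_iff, abs_of_pos hr, ← sub_eq_zero.1 h] at hp
    linarith
  have := circleAverage_of_differentiable_on_off_countable (f := fun p => (z - p)⁻¹) (c := 0)
    (R := r) countable_empty
    (fun p hp => ((continuousAt_const.sub continuousAt_id).inv₀ (hne p hp)).continuousWithinAt)
    (fun p hp => ((differentiableAt_const z).sub differentiableAt_id).inv
      (hne p (ball_subset_closedBall hp.1)))
  simpa using this

lemma circleAverage_inv_sub_of_gt {z : ℂ} {r : ℝ} (hz : ‖z‖ < r) :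
    Real.circleAverage (fun p => (z - p)⁻¹) 0 r = 0 := by
  have hr : 0 < r := (norm_nonneg z).trans_lt hz
  have hne : ∀ w ∈ closedBall (0 : ℂ) |1|, z * w - r ≠ 0 := by
    intro w hw h
    rw [mem_closedBall_zero_iff, abs_one] at hw
    have h1 : ‖z * w‖ = r := by
      rw [sub_eq_zero.1 h, Complex.norm_of_nonneg hr.le]
    rw [norm_mul] at h1
    nlinarith [norm_nonneg z]
  have hdiff : ∀ w ∈ closedBall (0 : ℂ) |1|, DifferentiableAt ℂ (fun w => w / (z * w - r)) w :=
    fun w hw => differentiableAt_id.div (by fun_prop) (hne w hw)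
  have h := circleAverage_of_differentiable_on_off_countable (f := fun w => w / (z * w - r))
    (c := 0) (R := 1) countable_empty
    (fun w hw => (hdiff w hw).continuousAt.continuousWithinAt)
    (fun w hw => hdiff w (ball_subset_closedBall hw.1))
  rw [zero_div] at h
  rw [Real.circleAverage_eq_circleAverage_zero_one,
    ← Real.circleAverage_zero_one_congr_inv (f := fun w => (z - (r * w + 0))⁻¹)]
  refine (Real.circleAverage_congr_sphere (f₂ := fun w => w / (z * w - r)) fun w hw => ?_).trans h
  have hw0 : w ≠ 0 := by
    rintro rfl
    simp at hw
  change (z - (r * w⁻¹ + 0))⁻¹ = w / (z * w - r)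
  rw [add_zero, ← inv_div]
  congr 1
  field_simp

lemma integral_Ioo_circleMap (f : ℂ → ℂ) (r : ℝ) :
    ∫ θ in Ioo (-Real.pi) Real.pi, f (circleMap 0 r θ) =
      (2 * Real.pi : ℝ) • Real.circleAverage f 0 r := by
  rw [Real.circleAverage_eq_integral_add (-Real.pi),
    intervalIntegral.integral_comp_add_right (fun θ => f (circleMap 0 r θ)), smul_smul,
    mul_inv_cancel₀ (by positivity), one_smul, ← integral_Ioc_eq_integral_Ioo,
    ← intervalIntegral.integral_of_le (by linarith [Real.pi_pos])]
  congr 1 <;> ring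

/-- The Cauchy transform of the indicator function of a disc, at points of the disc. -/
lemma integral_ball_inv_sub {R : ℝ} {z : ℂ} (hz : ‖z‖ < R) :
    ∫ p in ball 0 R, (z - p)⁻¹ = Real.pi * (starRingEnd ℂ) z := by
  set f : ℂ → ℂ := (ball (0 : ℂ) R).indicator fun p => (z - p)⁻¹ with hf
  have hfi : Integrable f :=
    (integrable_indicator_iff measurableSet_ball).2 (integrableOn_inv_sub_ball hz)
  have hfm : Measurable f := (measurable_const.sub measurable_id).inv.indicator measurableSet_ball
  have hsymm : Continuous fun x : ℝ × ℝ => Complex.polarCoord.symm x := by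
    simp only [Complex.polarCoord_symm_apply]
    fun_prop
  have hpolar : IntegrableOn (fun x : ℝ × ℝ => x.1 • f (Complex.polarCoord.symm x))
      (Ioi 0 ×ˢ Ioo (-Real.pi) Real.pi) := by
    refine ⟨(measurable_fst.smul (hfm.comp hsymm.measurable)).aestronglyMeasurable, ?_⟩
    have h := hfi.2
    rw [hasFiniteIntegral_iff_enorm, ← Complex.lintegral_comp_polarCoord_symm] at h
    rw [hasFiniteIntegral_iff_enorm]
    convert h using 1
    rw [polarCoord_target]
    refine setLIntegral_congr_fun (measurableSet_Ioi.prod measurableSet_Ioo) fun x hx => ?_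
    simp only [enorm_smul, smul_eq_mul]
    rw [Real.enorm_of_nonneg (le_of_lt hx.1)]
  have hcircle : ∀ r ∈ Ioi (0 : ℝ), r ≠ ‖z‖ →
      ∫ θ in Ioo (-Real.pi) Real.pi, r • f (Complex.polarCoord.symm (r, θ)) =
        (Ioo 0 ‖z‖).indicator (fun r : ℝ => (r : ℂ) * (2 * Real.pi * z⁻¹)) r := by
    intro r hr hrz
    have hr : 0 < r := hr
    have hmap : ∀ θ : ℝ, Complex.polarCoord.symm (r, θ) = circleMap 0 r θ := by
      intro θ
      rw [Complex.polarCoord_symm_apply, circleMap, Complex.exp_mul_I]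
      simp
    simp only [hmap]
    rw [integral_smul, integral_Ioo_circleMap]
    by_cases hrR : r < R
    · have : Real.circleAverage f 0 r = Real.circleAverage (fun p => (z - p)⁻¹) 0 r := by
        refine Real.circleAverage_congr_sphere fun w hw => indicator_of_mem ?_ _
        rw [mem_sphere_zero_iff_norm, abs_of_pos hr] at hw
        rwa [mem_ball_zero_iff, hw]
      rw [this]
      rcases lt_or_gt_of_ne hrz with h | h
      · rw [circleAverage_inv_sub_of_lt hr h, indicator_of_mem (show r ∈ Ioo 0 ‖z‖ from ⟨hr, h⟩)]
        simp
      · rw [circleAverage_inv_sub_of_gt h, indicator_of_notMem (fun h' => h.not_gt h'.2)]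
        simp
    · have : Real.circleAverage f 0 r = Real.circleAverage (fun _ => 0) 0 r := by
        refine Real.circleAverage_congr_sphere fun w hw => indicator_of_notMem ?_ _
        rw [mem_sphere_zero_iff_norm, abs_of_pos hr] at hw
        rwa [mem_ball_zero_iff, hw]
      rw [this, Real.circleAverage_const, indicator_of_notMem (fun h' => hrR (h'.2.trans hz))]
      simp
  rw [← integral_indicator measurableSet_ball, ← hf, ← Complex.integral_comp_polarCoord_symm,
    polarCoord_target, Measure.volume_eq_prod, setIntegral_prod _ hpolar]
  have hae : ∀ᵐ r : ℝ, r ∈ Ioi (0 : ℝ) →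
      ∫ θ in Ioo (-Real.pi) Real.pi, r • f (Complex.polarCoord.symm (r, θ)) =
        (Ioo 0 ‖z‖).indicator (fun r : ℝ => (r : ℂ) * (2 * Real.pi * z⁻¹)) r := by
    filter_upwards [Measure.ae_ne volume ‖z‖] with r hr hr0 using hcircle r hr0 hr
  rw [setIntegral_congr_ae measurableSet_Ioi hae, setIntegral_indicator measurableSet_Ioo,
    inter_eq_self_of_subset_right (fun r hr => hr.1), ← integral_Ioc_eq_integral_Ioo,
    ← intervalIntegral.integral_of_le (norm_nonneg z), intervalIntegral.integral_mul_const,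
    intervalIntegral.integral_ofReal, integral_id]
  by_cases hz0 : z = 0
  · simp [hz0]
  · have h1 : ((‖z‖ : ℝ) : ℂ) ^ 2 = (starRingEnd ℂ) z * z := by
      rw [mul_comm, Complex.mul_conj, Complex.normSq_eq_norm_sq]
      push_cast
      rfl
    push_cast
    rw [h1]
    field_simp
    ring

lemma integrable_cauchy_kernel (hη : Continuous η) (L : ℝ) :
    Integrable (Function.uncurry fun (s : ℝ) (p : ℂ) => tangent η s / (curve η s - p))
      ((volume.restrict (Ioc 0 L)).prod (volume.restrict (ball 0 (L + 1)))) := by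
  have hmeas : Measurable
      (Function.uncurry fun (s : ℝ) (p : ℂ) => tangent η s / (curve η s - p)) :=
    ((continuous_tangent hη).measurable.comp measurable_fst).div
      (((continuous_curve hη).measurable.comp measurable_fst).sub measurable_snd)
  have hlt : ∀ s ∈ Ioc 0 L, ‖curve η s‖ < L + 1 := fun s hs => by
    linarith [norm_curve_le hη (Ioc_subset_Icc_self hs)]
  have hnorm : ∀ (s : ℝ) (p : ℂ), ‖tangent η s / (curve η s - p)‖ = ‖(curve η s - p)⁻¹‖ :=
    fun s p => by rw [div_eq_mul_inv, norm_mul, norm_tangent, one_mul]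
  rw [integrable_prod_iff hmeas.aestronglyMeasurable]
  constructor
  · filter_upwards [ae_restrict_mem measurableSet_Ioc] with s hs
    exact (integrableOn_inv_sub_ball (hlt s hs)).const_mul (tangent η s)
  · refine Integrable.mono' (integrable_const (∫ q in ball (0 : ℂ) (L + 1 + (L + 1)), ‖q⁻¹‖))
      hmeas.norm.aestronglyMeasurable.integral_prod_right' ?_
    filter_upwards [ae_restrict_mem measurableSet_Ioc] with s hs
    rw [Real.norm_of_nonneg (integral_nonneg fun _ => norm_nonneg _)]
    simp only [Function.uncurry, hnorm]
    exact integral_norm_inv_sub_ball_le (hlt s hs)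

lemma integrableOn_winding (hη : Continuous η) {L : ℝ} (hL : 0 ≤ L) :
    IntegrableOn (winding η L) (ball 0 (L + 1)) := by
  have h := (integrable_cauchy_kernel hη L).integral_prod_right
  have h2 := (Complex.imCLM.integrable_comp h).div_const (2 * Real.pi)
  refine h2.congr (ae_of_all _ fun p => ?_)
  simp only [winding, cauchy, intervalIntegral.integral_of_le hL]
  rfl

lemma integral_cauchy (hη : Continuous η) {L : ℝ} (hL : 0 ≤ L) :
    ∫ p in ball 0 (L + 1), cauchy η 0 L p =
      Real.pi * ∫ s in (0 : ℝ)..L, tangent η s * (starRingEnd ℂ) (curve η s) := by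
  have h := integral_integral_swap (integrable_cauchy_kernel hη L)
  simp only [cauchy, intervalIntegral.integral_of_le hL]
  rw [← h, ← integral_const_mul]
  refine setIntegral_congr_fun measurableSet_Ioc fun s hs => ?_
  simp only [div_eq_mul_inv]
  rw [integral_const_mul, integral_ball_inv_sub (by
    linarith [norm_curve_le hη (Ioc_subset_Icc_self hs)])]
  ring

lemma curve_eq (hη : Continuous η) (s : ℝ) :
    curve η s = ((∫ u in (0 : ℝ)..s, Real.cos (η u) : ℝ) : ℂ) +
      ((-∫ u in (0 : ℝ)..s, Real.sin (η u) : ℝ) : ℂ) * Complex.I := by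
  have hi := (continuous_tangent hη).intervalIntegrable (μ := volume) 0 s
  have hre := Complex.reCLM.intervalIntegral_comp_comm hi
  have him := Complex.imCLM.intervalIntegral_comp_comm hi
  simp only [Complex.reCLM_apply, Complex.imCLM_apply, tangent, Complex.exp_ofReal_mul_I_re,
    Complex.exp_ofReal_mul_I_im, Real.cos_neg, Real.sin_neg] at hre him
  rw [intervalIntegral.integral_neg] at him
  apply Complex.ext
  · simpa [curve, tangent] using hre.symm
  · simpa [curve, tangent] using him.symm

lemma integral_winding (hη : Continuous η) {L : ℝ} (hL : 0 ≤ L)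
    (h1 : (∫ u in (0 : ℝ)..L, Real.cos (η u)) = 0) :
    ∫ p in ball 0 (L + 1), winding η L p =
      -∫ u in (0 : ℝ)..L, Real.sin (η u) * ∫ t in (0 : ℝ)..u, Real.cos (η t) := by
  have hcos : Continuous fun u => Real.cos (η u) := by fun_prop
  have hsin : Continuous fun u => Real.sin (η u) := by fun_prop
  set X : ℝ → ℝ := fun u => ∫ t in (0 : ℝ)..u, Real.cos (η t) with hX
  set Y : ℝ → ℝ := fun u => ∫ t in (0 : ℝ)..u, Real.sin (η t) with hY
  have hdX : ∀ u, HasDerivAt X (Real.cos (η u)) u := fun u =>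
    (hcos.integral_hasStrictDerivAt 0 u).hasDerivAt
  have hdY : ∀ u, HasDerivAt Y (Real.sin (η u)) u := fun u =>
    (hsin.integral_hasStrictDerivAt 0 u).hasDerivAt
  have hXc : Continuous X := continuous_iff_continuousAt.2 fun u => (hdX u).continuousAt
  have hYc : Continuous Y := continuous_iff_continuousAt.2 fun u => (hdY u).continuousAt
  have hparts : ∫ u in (0 : ℝ)..L, Real.cos (η u) * Y u =
      -∫ u in (0 : ℝ)..L, Real.sin (η u) * X u := by
    have := intervalIntegral.integral_mul_deriv_eq_deriv_mul (u := Y) (v := X) (a := 0) (b := L)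
      (fun x _ => hdY x) (fun x _ => hdX x) (hsin.intervalIntegrable _ _)
      (hcos.intervalIntegrable _ _)
    have hX0 : X 0 = 0 := by simp [hX]
    have hXL : X L = 0 := h1
    rw [hX0, hXL, mul_zero, mul_zero, sub_zero, zero_sub] at this
    simpa only [mul_comm] using this
  have hc : IntegrableOn (cauchy η 0 L) (ball 0 (L + 1)) := by
    have h := (integrable_cauchy_kernel hη L).integral_prod_right
    refine h.congr (ae_of_all _ fun p => ?_)
    simp only [cauchy, intervalIntegral.integral_of_le hL]
    rfl
  have him : ∀ s, (tangent η s * (starRingEnd ℂ) (curve η s)).im =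
      -(Real.sin (η s) * X s) + Real.cos (η s) * Y s := by
    intro s
    rw [curve_eq hη, Complex.mul_im, tangent, Complex.exp_ofReal_mul_I_re,
      Complex.exp_ofReal_mul_I_im, Real.cos_neg, Real.sin_neg]
    simp [hX, hY]
    ring
  have hint : (∫ s in (0 : ℝ)..L, tangent η s * (starRingEnd ℂ) (curve η s)).im =
      -2 * ∫ u in (0 : ℝ)..L, Real.sin (η u) * X u := by
    have hi : IntervalIntegrable (fun s => tangent η s * (starRingEnd ℂ) (curve η s))
        volume 0 L :=
      ((continuous_tangent hη).mul
        (Complex.continuous_conj.comp (continuous_curve hη))).intervalIntegrable _ _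
    have h := Complex.imCLM.intervalIntegral_comp_comm hi
    simp only [Complex.imCLM_apply, him] at h
    rw [intervalIntegral.integral_add (f := fun u => -(Real.sin (η u) * X u))
      (g := fun u => Real.cos (η u) * Y u) ((hsin.mul hXc).neg.intervalIntegrable _ _)
      ((hcos.mul hYc).intervalIntegrable _ _), intervalIntegral.integral_neg, hparts] at h
    rw [← h]
    ring
  have himc := Complex.imCLM.integral_comp_comm hc
  simp only [Complex.imCLM_apply] at himc
  simp only [winding]
  rw [integral_div, himc, integral_cauchy hη hL, Complex.im_ofReal_mul, hint]
  have := Real.pi_pos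
  field_simp
  rfl

lemma setIntegral_pos_of_eventually {f : ℂ → ℝ} {S : Set ℂ} (hS : IsOpen S)
    (hf : IntegrableOn f S) (h0 : ∀ᵐ p, 0 ≤ f p) {p : ℂ} (hp : p ∈ S)
    (hpos : ∀ᶠ q in 𝓝 p, f q ≠ 0) : 0 < ∫ q in S, f q := by
  rw [setIntegral_pos_iff_support_of_nonneg_ae (ae_restrict_of_ae h0) hf]
  exact Measure.measure_pos_of_mem_nhds volume (inter_mem hpos (hS.mem_nhds hp))

theorem integral_sin_mul_integral_cos_ne_zero (hη : Continuous η) {L : ℝ} (hL : 0 < L)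
    (hc : curve η L = 0) (hinj : InjOn (curve η) (Ico 0 L)) :
    (∫ u in (0 : ℝ)..L, Real.sin (η u) * ∫ t in (0 : ℝ)..u, Real.cos (η t)) ≠ 0 := by
  have h1 : (∫ u in (0 : ℝ)..L, Real.cos (η u)) = 0 := by
    have := congrArg Complex.re ((curve_eq hη L).symm.trans hc)
    simpa using this
  obtain ⟨k, hk⟩ := exists_forall_jumpsFrom hη hL hc hinj
  have hval := fun p hp => winding_eq_or_eq hη hL hc hinj hk (p := p) hp
  have hmid : L / 2 ∈ Ioo 0 L := ⟨by linarith, by linarith⟩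
  have hae : ∀ᵐ p, p ∉ trace η L := measure_eq_zero_iff_ae_notMem.1 (volume_trace hη L)
  have hball : ∀ᶠ p in 𝓝 (curve η (L / 2)), p ∈ ball (0 : ℂ) (L + 1) := by
    refine isOpen_ball.mem_nhds ?_
    rw [mem_ball_zero_iff]
    linarith [norm_curve_le hη (Ioo_subset_Icc_self hmid)]
  obtain ⟨p₀, hp₀, hw₀⟩ := exists_winding_eq_zero hη hL hc
  have hk01 : k = 0 ∨ k = -1 := by
    have := hval p₀ hp₀
    rw [hw₀] at this
    norm_cast at this
    omega
  intro hI
  have hzero := integral_winding hη hL.le h1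
  rw [hI, neg_zero] at hzero
  rcases hk01 with rfl | rfl
  · obtain ⟨p, ⟨hp, hpw⟩, hpb⟩ := ((hk _ hmid).2.2.and_eventually hball).exists
    refine (setIntegral_pos_of_eventually isOpen_ball (integrableOn_winding hη hL.le) ?_ hpb ?_).ne'
      hzero
    · filter_upwards [hae] with q hq
      rcases hval q hq with h | h <;> rw [h] <;> norm_num
    · filter_upwards [eventually_winding_eq hη hL.le hc hp] with q hq
      rw [hq.2, hpw]; norm_num
  · obtain ⟨p, ⟨hp, hpw⟩, hpb⟩ := ((hk _ hmid).2.1.and_eventually hball).exists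
    refine (setIntegral_pos_of_eventually (f := fun q => -winding η L q) isOpen_ball
      (integrableOn_winding hη hL.le).neg ?_ hpb ?_).ne' (by rw [integral_neg, hzero, neg_zero])
    · filter_upwards [hae] with q hq
      rcases hval q hq with h | h <;> rw [h] <;> norm_num
    · filter_upwards [eventually_winding_eq hη hL.le hc hp] with q hq
      rw [hq.2, hpw]; norm_num

end PlaneCurve

/-- For a simple closed unit-speed plane curve `Γ(s) = (∫₀^s cos η, -∫₀^s sin η)` of
period `L`, the signed-area integral `∫₀^L sin η(u) (∫₀^u cos η) du` is nonzero. -/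
theorem stmt_8 (L : ℝ) (hL : 0 < L) (η : ℝ → ℝ) (hη : ContDiff ℝ 1 η)
    (h1 : (∫ u in (0:ℝ)..L, Real.cos (η u)) = 0)
    (h2 : (∫ u in (0:ℝ)..L, Real.sin (η u)) = 0)
    (hsimple : Set.InjOn
      (fun s : ℝ => ((∫ u in (0:ℝ)..s, Real.cos (η u)),
        (-∫ u in (0:ℝ)..s, Real.sin (η u))))
      (Set.Ico 0 L)) :
    (∫ u in (0:ℝ)..L, Real.sin (η u) * ∫ t in (0:ℝ)..u, Real.cos (η t)) ≠ 0 := by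
  have hcont := hη.continuous
  refine PlaneCurve.integral_sin_mul_integral_cos_ne_zero hcont hL ?_ fun s hs u hu h => ?_
  · rw [PlaneCurve.curve_eq hcont, h1, h2]; simp
  · refine hsimple hs hu ?_
    rw [PlaneCurve.curve_eq hcont, PlaneCurve.curve_eq hcont] at h
    have hre := congrArg Complex.re h
    have him := congrArg Complex.im h
    simp at hre him
    exact Prod.ext hre (congrArg Neg.neg him)
end

section
/- Let l, m ≥ 1, n = l+m+2, H continuous, and let (x,y) be a unit-speed solution of l y'/x - m x'/y - (x''y' - x'y'') + (n-1)H = 0 with x,y > 0 on [0,b), such that x(s) → 0 and y(s) → 0 as s → b. Then lim_{s→b} x'(s)² exists and equals l/(l+m); in particular if s < b then x'(s) → -√(l/(l+m)) as s → b⁻. -/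
section

open Filter Topology Set

/-- A function with nonnegative derivative on `(a, b)` lies below its left limit at `b`. -/
lemma le_of_hasDerivAt_nonneg_of_tendsto {a b c : ℝ} {F F' : ℝ → ℝ}
    (hF : ∀ s ∈ Ioo a b, HasDerivAt F (F' s) s) (hF' : ∀ s ∈ Ioo a b, 0 ≤ F' s)
    (hlim : Tendsto F (𝓝[<] b) (𝓝 c)) {s : ℝ} (hs : s ∈ Ioo a b) : F s ≤ c := by
  have hmono : MonotoneOn F (Ioo a b) := by
    apply monotoneOn_of_deriv_nonneg (convex_Ioo a b)
      (fun t ht => (hF t ht).continuousAt.continuousWithinAt)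
    · rw [interior_Ioo]
      exact fun t ht => (hF t ht).differentiableAt.differentiableWithinAt
    · rw [interior_Ioo]
      intro t ht
      rw [(hF t ht).deriv]
      exact hF' t ht
  refine ge_of_tendsto hlim ?_
  filter_upwards [Ioo_mem_nhdsLT hs.2] with t ht
  exact hmono hs ⟨hs.1.trans ht.1, ht.2⟩ ht.1.le

/-- A function with positive derivative on `(a, b)` lies strictly below its left limit at `b`. -/
lemma lt_of_hasDerivAt_pos_of_tendsto {a b c : ℝ} {F F' : ℝ → ℝ}
    (hF : ∀ s ∈ Ioo a b, HasDerivAt F (F' s) s) (hF' : ∀ s ∈ Ioo a b, 0 < F' s)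
    (hlim : Tendsto F (𝓝[<] b) (𝓝 c)) {s : ℝ} (hs : s ∈ Ioo a b) : F s < c := by
  have hmono : StrictMonoOn F (Ioo a b) := by
    apply strictMonoOn_of_deriv_pos (convex_Ioo a b)
      (fun t ht => (hF t ht).continuousAt.continuousWithinAt)
    rw [interior_Ioo]
    intro t ht
    rw [(hF t ht).deriv]
    exact hF' t ht
  obtain ⟨t, hst, htb⟩ := exists_between hs.2
  have ht : t ∈ Ioo a b := ⟨hs.1.trans hst, htb⟩
  exact (hmono hs ht hst).trans_le
    (le_of_hasDerivAt_nonneg_of_tendsto hF (fun u hu => (hF' u hu).le) hlim ht)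

/-- A function whose derivative is at least `δ / (b - s) - M` is not bounded above near `b`. -/
lemma false_of_hasDerivAt_ge_div_sub {a b δ M B : ℝ} (hab : a < b) (hδ : 0 < δ) {F F' : ℝ → ℝ}
    (hF : ∀ s ∈ Ioo a b, HasDerivAt F (F' s) s)
    (hF' : ∀ s ∈ Ioo a b, δ / (b - s) - M ≤ F' s) (hB : ∀ s ∈ Ioo a b, F s ≤ B) : False := by
  have hderiv : ∀ s ∈ Ioo a b, HasDerivAt (fun s => F s + δ * Real.log (b - s) + M * s)
      (F' s + δ * (-1 / (b - s)) + M * 1) s := by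
    intro s hs
    have hbs : b - s ≠ 0 := (sub_pos.2 hs.2).ne'
    exact ((hF s hs).add ((((hasDerivAt_id s).const_sub b).log hbs).const_mul δ)).add
      ((hasDerivAt_id s).const_mul M)
  have hmono : MonotoneOn (fun s => F s + δ * Real.log (b - s) + M * s) (Ioo a b) := by
    apply monotoneOn_of_deriv_nonneg (convex_Ioo a b)
      (fun t ht => (hderiv t ht).continuousAt.continuousWithinAt)
    · rw [interior_Ioo]
      exact fun t ht => (hderiv t ht).differentiableAt.differentiableWithinAt
    · rw [interior_Ioo]
      intro t ht
      rw [(hderiv t ht).deriv]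
      have h1 := hF' t ht
      have h2 : δ * (-1 / (b - t)) = -(δ / (b - t)) := by ring
      rw [h2]
      linarith
  obtain ⟨s, hs⟩ := exists_between hab
  have hlog : Tendsto (fun t => B + δ * Real.log (b - t) + M * t) (𝓝[<] b) atBot := by
    have h1 : Tendsto (fun t => b - t) (𝓝[<] b) (𝓝[>] 0) := by
      apply tendsto_nhdsWithin_of_tendsto_nhds_of_eventually_within
      · have : Tendsto (fun t => b - t) (𝓝 b) (𝓝 (b - b)) := by
          exact (continuous_const.sub continuous_id).tendsto b
        rw [sub_self] at this
        exact this.mono_left nhdsWithin_le_nhds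
      · filter_upwards [self_mem_nhdsWithin] with t ht
        exact mem_Ioi.2 (sub_pos.2 (mem_Iio.1 ht))
    have h2 := (Real.tendsto_log_nhdsGT_zero.comp h1).const_mul_atBot hδ
    have h3 : Tendsto (fun t => M * t) (𝓝[<] b) (𝓝 (M * b)) :=
      ((continuous_const.mul continuous_id).tendsto b).mono_left nhdsWithin_le_nhds
    exact (tendsto_atBot_add_const_left _ B h2).atBot_add h3
  have hev := hlog.eventually (eventually_lt_atBot (F s + δ * Real.log (b - s) + M * s))
  obtain ⟨t, ht1, ht2⟩ := (hev.and (Ioo_mem_nhdsLT hs.2)).exists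
  have ht : t ∈ Ioo a b := ⟨hs.1.trans ht2.1, ht2.2⟩
  have h1 : F s + δ * Real.log (b - s) + M * s ≤ F t + δ * Real.log (b - t) + M * t :=
    hmono hs ht ht2.1.le
  have h2 := hB t ht
  linarith

/-- Weighted AM-GM on the circle: `X ^ l * Y ^ m` is maximal exactly at `X ^ 2 = l / (l + m)`. -/
lemma pow_mul_pow_lt_of_ne {l m : ℕ} (hl : 1 ≤ l) (hm : 1 ≤ m) {X Y : ℝ} (hX : 0 < X) (hY : 0 < Y)
    (hXY : X ^ 2 + Y ^ 2 = 1) (hne : X ≠ √((l : ℝ) / (l + m))) :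
    X ^ l * Y ^ m < √((l : ℝ) / (l + m)) ^ l * √((m : ℝ) / (l + m)) ^ m := by
  have hl' : (0 : ℝ) < l := by exact_mod_cast hl
  have hm' : (0 : ℝ) < m := by exact_mod_cast hm
  set p := √((l : ℝ) / (l + m)) with hp
  set q := √((m : ℝ) / (l + m)) with hq
  have hp0 : 0 < p := Real.sqrt_pos.2 (by positivity)
  have hq0 : 0 < q := Real.sqrt_pos.2 (by positivity)
  have hp2 : p ^ 2 = l / (l + m) := Real.sq_sqrt (by positivity)
  have hq2 : q ^ 2 = m / (l + m) := Real.sq_sqrt (by positivity)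
  have hsum : l * ((X / p) ^ 2 - 1) + m * ((Y / q) ^ 2 - 1) = 0 := by
    rw [div_pow, div_pow, hp2, hq2]
    field_simp
    linear_combination ((l : ℝ) + m) * hXY
  have hlogX : Real.log ((X / p) ^ 2) < (X / p) ^ 2 - 1 := by
    apply Real.log_lt_sub_one_of_pos (by positivity)
    intro h
    apply hne
    have : X / p = 1 := by
      nlinarith [div_pos hX hp0]
    rw [div_eq_one_iff_eq hp0.ne'] at this
    exact this
  have hlogY : Real.log ((Y / q) ^ 2) ≤ (Y / q) ^ 2 - 1 :=
    Real.log_le_sub_one_of_pos (by positivity)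
  have hlog : Real.log ((X / p) ^ l * (Y / q) ^ m) < 0 := by
    rw [Real.log_mul (by positivity) (by positivity), Real.log_pow, Real.log_pow]
    rw [Real.log_pow] at hlogX hlogY
    push_cast at hlogX hlogY
    nlinarith [mul_lt_mul_of_pos_left hlogX hl', mul_le_mul_of_nonneg_left hlogY hm'.le]
  have hlt : (X / p) ^ l * (Y / q) ^ m < 1 := by
    rw [← not_le]
    exact fun h => absurd (Real.log_nonneg h) (not_le.2 hlog)
  rw [div_pow, div_pow, div_mul_div_comm, div_lt_one (by positivity)] at hlt
  exact hlt

lemma HasDerivAt.fun_pow_div {f : ℝ → ℝ} {f' s : ℝ} (hf : HasDerivAt f f' s) (h0 : f s ≠ 0)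
    (n : ℕ) : HasDerivAt (fun t => f t ^ n) (f s ^ n * (n * f' / f s)) s := by
  refine (hf.fun_pow n).congr_deriv ?_
  cases n with
  | zero => simp
  | succ n =>
    rw [Nat.add_sub_cancel, pow_succ]
    field_simp

lemma dissipation_le {n e C k S A B B₂ : ℝ} (hn : 1 ≤ n) (heC : e ^ 2 + C ^ 2 = 1)
    (hk : k ^ 2 ≤ B ^ 2) (hS : S ≤ B₂) (hA : B ^ 2 + n ^ 2 + B₂ + 1 ≤ A) (hB₂ : 0 ≤ B₂) :
    k ^ 2 / 2 + e ^ 2 ≤ C ^ 2 * k ^ 2 + n * C * e * k - e ^ 2 * S + n * A * e ^ 2 := by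
  have hA0 : 0 ≤ A := le_trans (by positivity) hA
  have h1 : 0 ≤ (C * k + n * e) ^ 2 := sq_nonneg _
  have h2 : e ^ 2 * k ^ 2 ≤ e ^ 2 * B ^ 2 := by gcongr
  have h3 : e ^ 2 * S ≤ e ^ 2 * B₂ := by gcongr
  have h4 : e ^ 2 * (B ^ 2 + n ^ 2 + B₂ + 1) ≤ e ^ 2 * A := by gcongr
  have h5 : 1 * (A * e ^ 2) ≤ n * (A * e ^ 2) := by gcongr
  have h6 : C ^ 2 * k ^ 2 = k ^ 2 - e ^ 2 * k ^ 2 := by linear_combination k ^ 2 * heC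
  have h7 : 0 ≤ e ^ 2 * B ^ 2 := by positivity
  have h8 : 0 ≤ e ^ 2 * n ^ 2 := by positivity
  linarith

/-- The system satisfied by the unit direction `(X, Y)` of the position vector, the sine `e` and the
cosine `C` of the angle between velocity and the inward radial direction, the distance `r` to the
origin and the forcing term `h`. -/
structure ConeFlow (l m : ℕ) (a b : ℝ) (X Y e C r h : ℝ → ℝ) : Prop where
  hasDerivAt_X : ∀ s ∈ Ioo a b, HasDerivAt X (Y s * e s / r s) s
  hasDerivAt_Y : ∀ s ∈ Ioo a b, HasDerivAt Y (-(X s * e s / r s)) s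
  hasDerivAt_e : ∀ s ∈ Ioo a b, HasDerivAt e (C s * ((l + m + 1) * e s
    + C s * (l * Y s / X s - m * X s / Y s)) / r s - C s * h s) s
  hasDerivAt_C : ∀ s ∈ Ioo a b, HasDerivAt C (-(e s * ((l + m + 1) * e s
    + C s * (l * Y s / X s - m * X s / Y s))) / r s + e s * h s) s
  X_pos : ∀ s ∈ Ioo a b, 0 < X s
  Y_pos : ∀ s ∈ Ioo a b, 0 < Y s
  C_pos : ∀ s ∈ Ioo a b, 0 < C s
  r_pos : ∀ s ∈ Ioo a b, 0 < r s
  r_le : ∀ s ∈ Ioo a b, r s ≤ b - s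
  sq_add_sq : ∀ s ∈ Ioo a b, X s ^ 2 + Y s ^ 2 = 1
  e_sq_add_C_sq : ∀ s ∈ Ioo a b, e s ^ 2 + C s ^ 2 = 1

namespace ConeFlow

variable {l m : ℕ} {a b : ℝ} {X Y e C r h : ℝ → ℝ}

lemma mono (hf : ConeFlow l m a b X Y e C r h) {a' : ℝ} (ha : a ≤ a') :
    ConeFlow l m a' b X Y e C r h where
  hasDerivAt_X s hs := hf.hasDerivAt_X s (Ioo_subset_Ioo_left ha hs)
  hasDerivAt_Y s hs := hf.hasDerivAt_Y s (Ioo_subset_Ioo_left ha hs)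
  hasDerivAt_e s hs := hf.hasDerivAt_e s (Ioo_subset_Ioo_left ha hs)
  hasDerivAt_C s hs := hf.hasDerivAt_C s (Ioo_subset_Ioo_left ha hs)
  X_pos s hs := hf.X_pos s (Ioo_subset_Ioo_left ha hs)
  Y_pos s hs := hf.Y_pos s (Ioo_subset_Ioo_left ha hs)
  C_pos s hs := hf.C_pos s (Ioo_subset_Ioo_left ha hs)
  r_pos s hs := hf.r_pos s (Ioo_subset_Ioo_left ha hs)
  r_le s hs := hf.r_le s (Ioo_subset_Ioo_left ha hs)
  sq_add_sq s hs := hf.sq_add_sq s (Ioo_subset_Ioo_left ha hs)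
  e_sq_add_C_sq s hs := hf.e_sq_add_C_sq s (Ioo_subset_Ioo_left ha hs)

lemma X_le_one (hf : ConeFlow l m a b X Y e C r h) {s : ℝ} (hs : s ∈ Ioo a b) : X s ≤ 1 := by
  nlinarith [hf.sq_add_sq s hs, sq_nonneg (Y s), hf.X_pos s hs]

lemma Y_le_one (hf : ConeFlow l m a b X Y e C r h) {s : ℝ} (hs : s ∈ Ioo a b) : Y s ≤ 1 := by
  nlinarith [hf.sq_add_sq s hs, sq_nonneg (X s), hf.Y_pos s hs]

lemma C_le_one (hf : ConeFlow l m a b X Y e C r h) {s : ℝ} (hs : s ∈ Ioo a b) : C s ≤ 1 := by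
  nlinarith [hf.e_sq_add_C_sq s hs, sq_nonneg (e s), hf.C_pos s hs]

lemma abs_e_le_one (hf : ConeFlow l m a b X Y e C r h) {s : ℝ} (hs : s ∈ Ioo a b) :
    |e s| ≤ 1 := by
  rw [← sq_le_one_iff_abs_le_one]
  nlinarith [hf.e_sq_add_C_sq s hs, sq_nonneg (C s)]

lemma weight_pos (hf : ConeFlow l m a b X Y e C r h) {s : ℝ} (hs : s ∈ Ioo a b) :
    0 < X s ^ l * Y s ^ m :=
  mul_pos (pow_pos (hf.X_pos s hs) l) (pow_pos (hf.Y_pos s hs) m)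

lemma weight_le_one (hf : ConeFlow l m a b X Y e C r h) {s : ℝ} (hs : s ∈ Ioo a b) :
    X s ^ l * Y s ^ m ≤ 1 :=
  mul_le_one₀ (pow_le_one₀ (hf.X_pos s hs).le (hf.X_le_one hs)) (pow_pos (hf.Y_pos s hs) m).le
    (pow_le_one₀ (hf.Y_pos s hs).le (hf.Y_le_one hs))

/-- The energy `X ^ l * Y ^ m * C` is decreasing up to the forcing term. -/
lemma hasDerivAt_energy (hf : ConeFlow l m a b X Y e C r h) {s : ℝ} (hs : s ∈ Ioo a b) :
    HasDerivAt (fun t => X t ^ l * Y t ^ m * C t)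
      (X s ^ l * Y s ^ m * (-((l + m + 1) * e s ^ 2 / r s) + e s * h s)) s := by
  have hX := (hf.X_pos s hs).ne'
  have hY := (hf.Y_pos s hs).ne'
  have hr := (hf.r_pos s hs).ne'
  refine ((((hf.hasDerivAt_X s hs).fun_pow_div hX l).fun_mul
    ((hf.hasDerivAt_Y s hs).fun_pow_div hY m)).fun_mul (hf.hasDerivAt_C s hs)).congr_deriv ?_
  field_simp
  ring

lemma hasDerivAt_curvature (hf : ConeFlow l m a b X Y e C r h) {s : ℝ} (hs : s ∈ Ioo a b) :
    HasDerivAt (fun t => l * Y t / X t - m * X t / Y t)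
      (-(e s * (l / X s ^ 2 + m / Y s ^ 2) / r s)) s := by
  have hX := (hf.X_pos s hs).ne'
  have hY := (hf.Y_pos s hs).ne'
  have hr := (hf.r_pos s hs).ne'
  refine ((((hf.hasDerivAt_Y s hs).const_mul (l : ℝ)).fun_div (hf.hasDerivAt_X s hs) hX).fun_sub
    (((hf.hasDerivAt_X s hs).const_mul (m : ℝ)).fun_div (hf.hasDerivAt_Y s hs) hY)).congr_deriv ?_
  field_simp
  linear_combination (-(e s * (l * Y s ^ 2 + m * X s ^ 2))) * hf.sq_add_sq s hs

lemma frequently_lt (hf : ConeFlow l m a b X Y e C r h) (hab : a < b) {η K δ : ℝ} (hη : 0 < η)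
    (hXη : ∀ s ∈ Ioo a b, η ≤ X s) (hYη : ∀ s ∈ Ioo a b, η ≤ Y s)
    (hK : ∀ s ∈ Ioo a b, |h s| ≤ K) (hδ : 0 < δ) :
    ∃ᶠ s in 𝓝[<] b, (l * Y s / X s - m * X s / Y s) ^ 2 / 2 + e s ^ 2 < δ := by
  intro hev
  simp only [not_lt] at hev
  obtain ⟨a', ha', hge⟩ := (mem_nhdsLT_iff_exists_mem_Ico_Ioo_subset hab).1 hev
  replace hf := hf.mono ha'.1
  have hsub : Ioo a' b ⊆ Ioo a b := Ioo_subset_Ioo_left ha'.1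
  set B : ℝ := (l + m) / η with hBdef
  set B₂ : ℝ := (l + m) / η ^ 2 with hB₂def
  set A : ℝ := (B ^ 2 + (l + m + 1) ^ 2 + B₂ + 1) / η ^ (l + m) with hAdef
  have hB : 0 ≤ B := by positivity
  have hB₂ : 0 ≤ B₂ := by positivity
  have hA : 0 ≤ A := by positivity
  have hk : ∀ s ∈ Ioo a' b, |l * Y s / X s - m * X s / Y s| ≤ B := by
    intro s hs
    have hX := hf.X_pos s hs
    have hY := hf.Y_pos s hs
    have h1 : l * Y s / X s ≤ l / η := by
      apply div_le_div₀ (by positivity) _ hη (hXη s (hsub hs))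
      exact mul_le_of_le_one_right (by positivity) (hf.Y_le_one hs)
    have h2 : m * X s / Y s ≤ m / η := by
      apply div_le_div₀ (by positivity) _ hη (hYη s (hsub hs))
      exact mul_le_of_le_one_right (by positivity) (hf.X_le_one hs)
    have h3 : 0 ≤ l * Y s / X s := by positivity
    have h4 : 0 ≤ m * X s / Y s := by positivity
    have h5 : B = l / η + m / η := by rw [hBdef, add_div]
    rw [abs_le]
    constructor <;> linarith
  refine false_of_hasDerivAt_ge_div_sub (a := a') (b := b) (δ := δ) (M := K * (B + A))
    (B := B) ha'.2 hδ (F := fun t => e t * (l * Y t / X t - m * X t / Y t)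
      - A * (X t ^ l * Y t ^ m * C t))
    (fun s hs => ((hf.hasDerivAt_e s hs).mul (hf.hasDerivAt_curvature hs)).sub
      ((hf.hasDerivAt_energy hs).const_mul A)) ?_ ?_
  · intro s hs
    have hX := hf.X_pos s hs
    have hY := hf.Y_pos s hs
    have hr := hf.r_pos s hs
    have hC := hf.C_pos s hs
    have hk1 := hk s hs
    have hδs : δ ≤ (l * Y s / X s - m * X s / Y s) ^ 2 / 2 + e s ^ 2 := hge hs
    have hS : l / X s ^ 2 + m / Y s ^ 2 ≤ B₂ := by
      rw [hB₂def, add_div]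
      gcongr
      · exact hXη s (hsub hs)
      · exact hYη s (hsub hs)
    have hw : η ^ (l + m) ≤ X s ^ l * Y s ^ m := by
      rw [pow_add]
      gcongr
      · exact hXη s (hsub hs)
      · exact hYη s (hsub hs)
    have hAw : B ^ 2 + (l + m + 1) ^ 2 + B₂ + 1 ≤ A * (X s ^ l * Y s ^ m) := by
      rw [hAdef, div_mul_eq_mul_div, le_div_iff₀ (by positivity)]
      gcongr
    have hw1 := hf.weight_le_one hs
    have hw0 := hf.weight_pos hs
    have hC1 := hf.C_le_one hs
    have he1 := hf.abs_e_le_one hs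
    have heC := hf.e_sq_add_C_sq s hs
    have hh := hK s (hsub hs)
    set k := l * Y s / X s - m * X s / Y s with hkdef
    set S := l / X s ^ 2 + m / Y s ^ 2 with hSdef
    set w := X s ^ l * Y s ^ m with hwdef
    have hforce : |h s * (C s * k + A * w * e s)| ≤ K * (B + A) := by
      rw [abs_mul]
      apply mul_le_mul hh _ (abs_nonneg _) ((abs_nonneg _).trans hh)
      refine (abs_add_le _ _).trans (add_le_add ?_ ?_)
      · rw [abs_mul, abs_of_pos hC]
        exact (mul_le_of_le_one_left (abs_nonneg _) hC1).trans hk1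
      · rw [abs_mul, abs_of_nonneg (by positivity)]
        calc A * w * |e s| ≤ A * w := mul_le_of_le_one_right (by positivity) he1
          _ ≤ A := mul_le_of_le_one_right hA hw1
    have hmain : δ ≤ C s ^ 2 * k ^ 2 + (l + m + 1) * C s * e s * k - e s ^ 2 * S
        + (l + m + 1) * (A * w) * e s ^ 2 := by
      have hkB : k ^ 2 ≤ B ^ 2 := sq_le_sq' (abs_le.1 hk1).1 (abs_le.1 hk1).2
      exact hδs.trans (dissipation_le (le_add_of_nonneg_left (by positivity)) heC hkB hS hAw hB₂)
    have hrb : δ / (b - s) ≤ δ / r s := by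
      have := hf.r_le s hs
      gcongr
    have hdiv : δ / r s ≤ (C s ^ 2 * k ^ 2 + (l + m + 1) * C s * e s * k - e s ^ 2 * S
        + (l + m + 1) * (A * w) * e s ^ 2) / r s := by gcongr
    have hforce' := (abs_le.1 hforce).2
    have hexp : (C s * ((l + m + 1) * e s + C s * k) / r s - C s * h s) * k
        + e s * -(e s * S / r s) - A * (w * (-((l + m + 1) * e s ^ 2 / r s) + e s * h s))
        = (C s ^ 2 * k ^ 2 + (l + m + 1) * C s * e s * k - e s ^ 2 * S
          + (l + m + 1) * (A * w) * e s ^ 2) / r s - h s * (C s * k + A * w * e s) := by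
      ring
    rw [hexp]
    linarith
  · intro s hs
    have hE : 0 ≤ A * (X s ^ l * Y s ^ m * C s) :=
      mul_nonneg hA (mul_pos (hf.weight_pos hs) (hf.C_pos s hs)).le
    have h1 : |e s * (l * Y s / X s - m * X s / Y s)| ≤ B := by
      rw [abs_mul]
      exact (mul_le_of_le_one_left (abs_nonneg _) (hf.abs_e_le_one hs)).trans (hk s hs)
    have h2 := (abs_le.1 h1).2
    linarith

lemma le_energy (hl : 1 ≤ l) (hm : 1 ≤ m)
    (hf : ConeFlow l m a b X Y e C r h) (hab : a < b) {η K : ℝ} (hη : 0 < η)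
    (hXη : ∀ s ∈ Ioo a b, η ≤ X s) (hYη : ∀ s ∈ Ioo a b, η ≤ Y s)
    (hK : ∀ s ∈ Ioo a b, |h s| ≤ K) {s : ℝ} (hs : s ∈ Ioo a b) :
    √((l : ℝ) / (l + m)) ^ l * √((m : ℝ) / (l + m)) ^ m - K * (b - s)
      ≤ X s ^ l * Y s ^ m * C s := by
  have hl' : (0 : ℝ) < l := by exact_mod_cast hl
  have hm' : (0 : ℝ) < m := by exact_mod_cast hm
  have hcluster : MapClusterPt (0 : ℝ) (𝓝[<] b)
      (fun s => (l * Y s / X s - m * X s / Y s) ^ 2 / 2 + e s ^ 2) := by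
    rw [mapClusterPt_iff_frequently]
    intro u hu
    obtain ⟨δ, hδ, hball⟩ := Metric.mem_nhds_iff.1 hu
    refine (hf.frequently_lt hab hη hXη hYη hK hδ).mono fun t ht => hball ?_
    rw [Metric.mem_ball, Real.dist_eq, sub_zero, abs_of_nonneg (by positivity)]
    exact ht
  obtain ⟨U, hU, hUlim⟩ := mapClusterPt_iff_ultrafilter.1 hcluster
  have hIoo : ∀ᶠ t in (U : Filter ℝ), t ∈ Ioo s b := hU (Ioo_mem_nhdsLT hs.2)
  have hIoo' : ∀ᶠ t in (U : Filter ℝ), t ∈ Ioo a b :=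
    hIoo.mono fun t ht => Ioo_subset_Ioo_left hs.1.le ht
  have he2 : Tendsto (fun t => e t ^ 2) U (𝓝 0) :=
    squeeze_zero (fun t => sq_nonneg _)
      (fun t => le_add_of_nonneg_left (by positivity)) hUlim
  have hk2 : Tendsto (fun t => (l * Y t / X t - m * X t / Y t) ^ 2) U (𝓝 0) := by
    have := hUlim.const_mul 2
    rw [mul_zero] at this
    refine squeeze_zero (fun t => sq_nonneg _) (fun t => ?_) this
    nlinarith [sq_nonneg (e t)]
  have hX2 : Tendsto (fun t => (l - (l + m) * X t ^ 2) ^ 2) U (𝓝 0) := by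
    refine squeeze_zero' (Eventually.of_forall fun t => sq_nonneg _) ?_ hk2
    filter_upwards [hIoo'] with t ht
    have hX := hf.X_pos t ht
    have hY := hf.Y_pos t ht
    have h1 : (l - (l + m) * X t ^ 2 : ℝ)
        = (l * Y t / X t - m * X t / Y t) * (X t * Y t) := by
      field_simp
      linear_combination (-(l : ℝ)) * hf.sq_add_sq t ht
    rw [h1, mul_pow]
    apply mul_le_of_le_one_right (sq_nonneg _)
    exact pow_le_one₀ (by positivity) (mul_le_one₀ (hf.X_le_one ht) hY.le (hf.Y_le_one ht))
  have hX1 : Tendsto (fun t => (l - (l + m) * X t ^ 2 : ℝ)) U (𝓝 0) := by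
    have := hX2.sqrt
    simp only [Real.sqrt_sq_eq_abs, Real.sqrt_zero] at this
    exact (tendsto_zero_iff_abs_tendsto_zero _).2 this
  have hXsq : Tendsto (fun t => X t ^ 2) U (𝓝 ((l : ℝ) / (l + m))) := by
    have := (hX1.const_sub (l : ℝ)).div_const ((l : ℝ) + m)
    rw [sub_zero] at this
    refine this.congr fun t => ?_
    field_simp
    ring
  have hYsq : Tendsto (fun t => Y t ^ 2) U (𝓝 ((m : ℝ) / (l + m))) := by
    have h1 := hXsq.const_sub 1
    have h2 : (1 : ℝ) - l / (l + m) = m / (l + m) := by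
      field_simp
      ring
    rw [h2] at h1
    refine h1.congr' ?_
    filter_upwards [hIoo'] with t ht
    linarith [hf.sq_add_sq t ht]
  have hCsq : Tendsto (fun t => C t ^ 2) U (𝓝 1) := by
    have h1 := he2.const_sub 1
    rw [sub_zero] at h1
    refine h1.congr' ?_
    filter_upwards [hIoo'] with t ht
    linarith [hf.e_sq_add_C_sq t ht]
  have hXlim : Tendsto X U (𝓝 √((l : ℝ) / (l + m))) := by
    refine hXsq.sqrt.congr' ?_
    filter_upwards [hIoo'] with t ht
    exact Real.sqrt_sq (hf.X_pos t ht).le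
  have hYlim : Tendsto Y U (𝓝 √((m : ℝ) / (l + m))) := by
    refine hYsq.sqrt.congr' ?_
    filter_upwards [hIoo'] with t ht
    exact Real.sqrt_sq (hf.Y_pos t ht).le
  have hClim : Tendsto C U (𝓝 1) := by
    have := hCsq.sqrt
    rw [Real.sqrt_one] at this
    refine this.congr' ?_
    filter_upwards [hIoo'] with t ht
    exact Real.sqrt_sq (hf.C_pos t ht).le
  have hElim := ((hXlim.pow l).mul (hYlim.pow m)).mul hClim
  rw [mul_one] at hElim
  have hid : Tendsto (fun t : ℝ => K * (t - s)) U (𝓝 (K * (b - s))) :=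
    (((continuous_id.sub continuous_const).const_mul K).tendsto b).mono_left
      (hU.trans nhdsWithin_le_nhds)
  refine le_of_tendsto (hElim.sub hid) ?_
  filter_upwards [hIoo] with t ht
  have hanti : AntitoneOn (fun t => X t ^ l * Y t ^ m * C t - K * t) (Ioo a b) := by
    have hd : ∀ t ∈ Ioo a b, HasDerivAt (fun t => X t ^ l * Y t ^ m * C t - K * t)
        (X t ^ l * Y t ^ m * (-((l + m + 1) * e t ^ 2 / r t) + e t * h t) - K * 1) t :=
      fun t ht => (hf.hasDerivAt_energy ht).sub ((hasDerivAt_id t).const_mul K)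
    apply antitoneOn_of_deriv_nonpos (convex_Ioo a b)
      (fun t ht => (hd t ht).continuousAt.continuousWithinAt)
    · rw [interior_Ioo]
      exact fun t ht => (hd t ht).differentiableAt.differentiableWithinAt
    · rw [interior_Ioo]
      intro t ht
      rw [(hd t ht).deriv]
      have hr := hf.r_pos t ht
      have hw := hf.weight_pos ht
      have hw1 := hf.weight_le_one ht
      have h1 : 0 ≤ X t ^ l * Y t ^ m * ((l + m + 1) * e t ^ 2 / r t) := by positivity
      have h2 : |X t ^ l * Y t ^ m * (e t * h t)| ≤ K := by
        rw [abs_mul, abs_of_pos hw, abs_mul]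
        calc _ ≤ |e t| * |h t| := mul_le_of_le_one_left (by positivity) hw1
          _ ≤ |h t| := mul_le_of_le_one_left (abs_nonneg _) (hf.abs_e_le_one ht)
          _ ≤ K := hK t ht
      have h3 := (abs_le.1 h2).2
      linarith
  have := hanti hs ⟨hs.1.trans ht.1, ht.2⟩ ht.1.le
  simp only at this
  linarith

lemma tendsto_X_C (hl : 1 ≤ l) (hm : 1 ≤ m)
    (hf : ConeFlow l m a b X Y e C r h) (hab : a < b) {η K : ℝ} (hη : 0 < η)
    (hXη : ∀ s ∈ Ioo a b, η ≤ X s) (hYη : ∀ s ∈ Ioo a b, η ≤ Y s)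
    (hK : ∀ s ∈ Ioo a b, |h s| ≤ K) :
    Tendsto X (𝓝[<] b) (𝓝 √((l : ℝ) / (l + m))) ∧ Tendsto C (𝓝[<] b) (𝓝 1) := by
  have hl' : (0 : ℝ) < l := by exact_mod_cast hl
  have hm' : (0 : ℝ) < m := by exact_mod_cast hm
  set p := √((l : ℝ) / (l + m)) with hp
  set q := √((m : ℝ) / (l + m)) with hq
  have hp0 : 0 < p := Real.sqrt_pos.2 (by positivity)
  have hq0 : 0 < q := Real.sqrt_pos.2 (by positivity)
  have hpq : p ^ 2 + q ^ 2 = 1 := by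
    rw [hp, hq, Real.sq_sqrt (by positivity), Real.sq_sqrt (by positivity)]
    field_simp
  have hmem : ∀ᶠ s in 𝓝[<] b, s ∈ Ioo a b := Ioo_mem_nhdsLT hab
  have hmax : ∀ s ∈ Ioo a b, X s ^ l * Y s ^ m ≤ p ^ l * q ^ m := by
    intro s hs
    by_cases hne : X s = p
    · have : Y s = q := by
        have h1 : Y s ^ 2 = q ^ 2 := by
          have := hf.sq_add_sq s hs
          rw [hne] at this
          linarith
        exact (sq_eq_sq₀ (hf.Y_pos s hs).le hq0.le).1 h1
      rw [hne, this]
    · exact (pow_mul_pow_lt_of_ne hl hm (hf.X_pos s hs) (hf.Y_pos s hs)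
        (hf.sq_add_sq s hs) hne).le
  have hlow : Tendsto (fun s => p ^ l * q ^ m - K * (b - s)) (𝓝[<] b) (𝓝 (p ^ l * q ^ m)) := by
    have : Tendsto (fun s => p ^ l * q ^ m - K * (b - s)) (𝓝 b)
        (𝓝 (p ^ l * q ^ m - K * (b - b))) :=
      (continuous_const.sub ((continuous_const.sub continuous_id).const_mul K)).tendsto b
    rw [sub_self, mul_zero, sub_zero] at this
    exact this.mono_left nhdsWithin_le_nhds
  have hen : ∀ s ∈ Ioo a b, p ^ l * q ^ m - K * (b - s) ≤ X s ^ l * Y s ^ m * C s :=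
    fun s hs => hf.le_energy hl hm hab hη hXη hYη hK hs
  have hw : Tendsto (fun s => X s ^ l * Y s ^ m) (𝓝[<] b) (𝓝 (p ^ l * q ^ m)) := by
    refine tendsto_of_tendsto_of_tendsto_of_le_of_le' hlow tendsto_const_nhds ?_ ?_
    · filter_upwards [hmem] with s hs
      exact (hen s hs).trans (mul_le_of_le_one_right (hf.weight_pos hs).le (hf.C_le_one hs))
    · filter_upwards [hmem] with s hs using hmax s hs
  constructor
  · rw [tendsto_iff_ultrafilter]
    intro U hU
    have hUmem : ∀ᶠ s in (U : Filter ℝ), s ∈ Ioo a b := hU hmem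
    have hmapX : Icc η 1 ∈ U.map X := by
      exact Ultrafilter.mem_map.2 (hUmem.mono fun s hs => ⟨hXη s hs, hf.X_le_one hs⟩)
    have hmapY : Icc η 1 ∈ U.map Y := by
      exact Ultrafilter.mem_map.2 (hUmem.mono fun s hs => ⟨hYη s hs, hf.Y_le_one hs⟩)
    obtain ⟨x₀, hx₀, hXx⟩ := isCompact_Icc.ultrafilter_le_nhds' (U.map X) hmapX
    obtain ⟨y₀, hy₀, hYy⟩ := isCompact_Icc.ultrafilter_le_nhds' (U.map Y) hmapY
    replace hXx : Tendsto X U (𝓝 x₀) := hXx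
    replace hYy : Tendsto Y U (𝓝 y₀) := hYy
    have hcirc : x₀ ^ 2 + y₀ ^ 2 = 1 := by
      refine tendsto_nhds_unique_of_eventuallyEq ((hXx.pow 2).add (hYy.pow 2))
        (tendsto_const_nhds (x := (1 : ℝ))) ?_
      filter_upwards [hUmem] with s hs using hf.sq_add_sq s hs
    have hval : x₀ ^ l * y₀ ^ m = p ^ l * q ^ m :=
      tendsto_nhds_unique ((hXx.pow l).mul (hYy.pow m)) (hw.mono_left hU)
    by_cases hne : x₀ = p
    · rwa [hne] at hXx
    · exact absurd hval (pow_mul_pow_lt_of_ne hl hm (hη.trans_le hx₀.1) (hη.trans_le hy₀.1)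
        hcirc hne).ne
  · have hdiv := hlow.div_const (p ^ l * q ^ m)
    rw [div_self (by positivity)] at hdiv
    refine tendsto_of_tendsto_of_tendsto_of_le_of_le' hdiv tendsto_const_nhds ?_ ?_
    · filter_upwards [hmem] with s hs
      rw [div_le_iff₀ (by positivity), mul_comm (C s)]
      exact (hen s hs).trans (mul_le_mul_of_nonneg_right (hmax s hs) (hf.C_pos s hs).le)
    · filter_upwards [hmem] with s hs using hf.C_le_one hs

end ConeFlow

/-- A unit-speed generating curve in the open quadrant whose hypersurface of
`O(l+1) × O(m+1)`-type has (unnormalized) mean curvature `h`. -/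
structure ProfileCurve (l m : ℕ) (a b : ℝ) (x y x' y' h : ℝ → ℝ) : Prop where
  hasDerivAt_x : ∀ s ∈ Ioo a b, HasDerivAt x (x' s) s
  hasDerivAt_y : ∀ s ∈ Ioo a b, HasDerivAt y (y' s) s
  hasDerivAt_x' : ∀ s ∈ Ioo a b,
    HasDerivAt x' (y' s * (l * y' s / x s - m * x' s / y s + h s)) s
  hasDerivAt_y' : ∀ s ∈ Ioo a b,
    HasDerivAt y' (-(x' s * (l * y' s / x s - m * x' s / y s + h s))) s
  x_pos : ∀ s ∈ Ioo a b, 0 < x s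
  y_pos : ∀ s ∈ Ioo a b, 0 < y s
  unit : ∀ s ∈ Ioo a b, x' s ^ 2 + y' s ^ 2 = 1

namespace ProfileCurve

variable {l m : ℕ} {a b : ℝ} {x y x' y' h : ℝ → ℝ}

lemma mono (hc : ProfileCurve l m a b x y x' y' h) {a' : ℝ} (ha : a ≤ a') :
    ProfileCurve l m a' b x y x' y' h where
  hasDerivAt_x s hs := hc.hasDerivAt_x s (Ioo_subset_Ioo_left ha hs)
  hasDerivAt_y s hs := hc.hasDerivAt_y s (Ioo_subset_Ioo_left ha hs)
  hasDerivAt_x' s hs := hc.hasDerivAt_x' s (Ioo_subset_Ioo_left ha hs)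
  hasDerivAt_y' s hs := hc.hasDerivAt_y' s (Ioo_subset_Ioo_left ha hs)
  x_pos s hs := hc.x_pos s (Ioo_subset_Ioo_left ha hs)
  y_pos s hs := hc.y_pos s (Ioo_subset_Ioo_left ha hs)
  unit s hs := hc.unit s (Ioo_subset_Ioo_left ha hs)

lemma swap (hc : ProfileCurve l m a b x y x' y' h) :
    ProfileCurve m l a b y x y' x' (fun s => -h s) where
  hasDerivAt_x := hc.hasDerivAt_y
  hasDerivAt_y := hc.hasDerivAt_x
  hasDerivAt_x' s hs := (hc.hasDerivAt_y' s hs).congr_deriv (by ring)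
  hasDerivAt_y' s hs := (hc.hasDerivAt_x' s hs).congr_deriv (by ring)
  x_pos := hc.y_pos
  y_pos := hc.x_pos
  unit s hs := by rw [add_comm]; exact hc.unit s hs

/-- The first variation identity for the translation along the first axis. -/
lemma hasDerivAt_momentum (hc : ProfileCurve l m a b x y x' y' h) {s : ℝ} (hs : s ∈ Ioo a b) :
    HasDerivAt (fun t => x t ^ l * y t ^ m * x' t)
      (x s ^ l * y s ^ m * (l / x s + h s * y' s)) s := by
  have hx := (hc.x_pos s hs).ne'
  have hy := (hc.y_pos s hs).ne'
  refine ((((hc.hasDerivAt_x s hs).fun_pow_div hx l).fun_mul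
    ((hc.hasDerivAt_y s hs).fun_pow_div hy m)).fun_mul (hc.hasDerivAt_x' s hs)).congr_deriv ?_
  field_simp
  linear_combination (l : ℝ) * y s * hc.unit s hs

lemma tendsto_momentum (hc : ProfileCurve l m a b x y x' y' h) (hl : 1 ≤ l) (hab : a < b)
    (hx : Tendsto x (𝓝[<] b) (𝓝 0)) (hy : Tendsto y (𝓝[<] b) (𝓝 0)) :
    Tendsto (fun s => x s ^ l * y s ^ m * x' s) (𝓝[<] b) (𝓝 0) := by
  have hw := (hx.pow l).mul (hy.pow m)
  rw [zero_pow (by lia), zero_mul] at hw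
  rw [tendsto_zero_iff_abs_tendsto_zero] at hw ⊢
  refine squeeze_zero' (Eventually.of_forall fun s => abs_nonneg _) ?_ hw
  filter_upwards [Ioo_mem_nhdsLT hab] with s hs
  simp only [Function.comp_apply]
  rw [abs_mul]
  apply mul_le_of_le_one_right (abs_nonneg _)
  rw [← sq_le_one_iff_abs_le_one]
  nlinarith [hc.unit s hs, sq_nonneg (y' s)]

lemma abs_mul_lt {K δ : ℝ} (hc : ProfileCurve l m a b x y x' y' h) {s : ℝ} (hs : s ∈ Ioo a b)
    (hK : |h s| ≤ K) {u : ℝ} (hu : 0 < u) (huK : K * u < δ) :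
    |u * (h s * x' s)| < δ ∧ |u * (h s * y' s)| < δ := by
  have hunit := hc.unit s hs
  have hx1 : |x' s| ≤ 1 := by
    rw [← sq_le_one_iff_abs_le_one]
    nlinarith [sq_nonneg (y' s)]
  have hy1 : |y' s| ≤ 1 := by
    rw [← sq_le_one_iff_abs_le_one]
    nlinarith [sq_nonneg (x' s)]
  rw [abs_mul, abs_mul, abs_mul, abs_mul, abs_of_pos hu]
  have h1 : |h s| * |x' s| ≤ K := (mul_le_of_le_one_right (abs_nonneg _) hx1).trans hK
  have h2 : |h s| * |y' s| ≤ K := (mul_le_of_le_one_right (abs_nonneg _) hy1).trans hK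
  constructor <;> nlinarith

lemma neg_and_sq_lt (hc : ProfileCurve l m a b x y x' y' h) (hl : 1 ≤ l) (hm : 1 ≤ m)
    (hab : a < b) (hx : Tendsto x (𝓝[<] b) (𝓝 0)) (hy : Tendsto y (𝓝[<] b) (𝓝 0)) {K δ : ℝ}
    (hK : ∀ s ∈ Ioo a b, |h s| ≤ K) (hδ : δ * (m + 3) ≤ 1)
    (hxK : ∀ s ∈ Ioo a b, K * x s < δ) (hyK : ∀ s ∈ Ioo a b, K * y s < δ)
    {s : ℝ} (hs : s ∈ Ioo a b) : x' s < 0 ∧ y s ^ 2 < (m + 2) * x s ^ 2 := by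
  have hl' : (1 : ℝ) ≤ l := by exact_mod_cast hl
  have hw : ∀ s ∈ Ioo a b, 0 < x s ^ l * y s ^ m := fun s hs =>
    mul_pos (pow_pos (hc.x_pos s hs) l) (pow_pos (hc.y_pos s hs) m)
  have hRlim := hc.tendsto_momentum hl hab hx hy
  have hQlim := hc.swap.tendsto_momentum hm hab hy hx
  constructor
  · have hR := lt_of_hasDerivAt_pos_of_tendsto (fun s hs => hc.hasDerivAt_momentum hs) ?_ hRlim hs
    · exact (pos_iff_neg_of_mul_neg hR).1 (hw s hs)
    · intro s hs
      have h1 := (abs_lt.1 (hc.abs_mul_lt hs (hK s hs) (hc.x_pos s hs) (hxK s hs)).2).1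
      have hx0 := hc.x_pos s hs
      have h2 : l / x s + h s * y' s = (l + x s * (h s * y' s)) / x s := by field_simp
      rw [h2]
      refine mul_pos (hw s hs) (div_pos ?_ hx0)
      nlinarith
  · have hZ : ∀ s ∈ Ioo a b, (m + 2) * (x s * x' s) - y s * y' s < 0 := by
      intro s hs
      have hd : ∀ s ∈ Ioo a b, HasDerivAt
          (fun t => (m + 2) * (x t * (x t ^ l * y t ^ m * x' t))
            - y t * (y t ^ m * x t ^ l * y' t))
          (x s ^ l * y s ^ m * ((m + 2) * (x' s ^ 2 + l + x s * (h s * y' s))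
            - (y' s ^ 2 + m - y s * (h s * x' s)))) s := by
        intro s hs
        have hx0 := (hc.x_pos s hs).ne'
        have hy0 := (hc.y_pos s hs).ne'
        refine ((((hc.hasDerivAt_x s hs).fun_mul (hc.hasDerivAt_momentum hs)).const_mul
          ((m : ℝ) + 2)).fun_sub
          ((hc.hasDerivAt_y s hs).fun_mul (hc.swap.hasDerivAt_momentum hs))).congr_deriv ?_
        field_simp
        ring
      have hlim := ((hx.mul hRlim).const_mul ((m : ℝ) + 2)).sub (hy.mul hQlim)
      simp only [mul_zero, sub_zero] at hlim
      have hlt := lt_of_hasDerivAt_pos_of_tendsto hd ?_ hlim hs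
      · have h1 : (m + 2) * (x s * (x s ^ l * y s ^ m * x' s)) - y s * (y s ^ m * x s ^ l * y' s)
            = x s ^ l * y s ^ m * ((m + 2) * (x s * x' s) - y s * y' s) := by ring
        rw [h1] at hlt
        exact (pos_iff_neg_of_mul_neg hlt).1 (hw s hs)
      · intro s hs
        refine mul_pos (hw s hs) ?_
        have h1 := (abs_lt.1 (hc.abs_mul_lt hs (hK s hs) (hc.x_pos s hs) (hxK s hs)).2).1
        have h2 := (abs_lt.1 (hc.abs_mul_lt hs (hK s hs) (hc.y_pos s hs) (hyK s hs)).1).1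
        have h3 := hc.unit s hs
        have h4 : ((m : ℝ) + 2) * 1 ≤ (m + 2) * l := by gcongr
        have h5 : ((m : ℝ) + 2) * (-δ) < (m + 2) * (x s * (h s * y' s)) := by gcongr
        have h6 : 0 ≤ ((m : ℝ) + 3) * x' s ^ 2 := by positivity
        linarith
    have hd : ∀ s ∈ Ioo a b, HasDerivAt (fun t => y t ^ 2 - (m + 2) * x t ^ 2)
        (-(2 * ((m + 2) * (x s * x' s) - y s * y' s))) s := by
      intro s hs
      refine (((hc.hasDerivAt_y s hs).fun_pow 2).fun_sub
        (((hc.hasDerivAt_x s hs).fun_pow 2).const_mul ((m : ℝ) + 2))).congr_deriv ?_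
      push_cast
      ring
    have hlim := (hy.pow 2).sub ((hx.pow 2).const_mul ((m : ℝ) + 2))
    norm_num at hlim
    have := lt_of_hasDerivAt_pos_of_tendsto hd (fun s hs => by linarith [hZ s hs]) hlim hs
    linarith

lemma hasDerivAt_radius (hc : ProfileCurve l m a b x y x' y' h) {s : ℝ} (hs : s ∈ Ioo a b) :
    HasDerivAt (fun t => √(x t ^ 2 + y t ^ 2))
      ((x s * x' s + y s * y' s) / √(x s ^ 2 + y s ^ 2)) s := by
  have hx := hc.x_pos s hs
  have hpos : x s ^ 2 + y s ^ 2 ≠ 0 := by positivity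
  refine ((((hc.hasDerivAt_x s hs).fun_pow 2).fun_add
    ((hc.hasDerivAt_y s hs).fun_pow 2)).sqrt hpos).congr_deriv ?_
  push_cast
  ring

lemma coneFlow (hc : ProfileCurve l m a b x y x' y' h)
    (hx : Tendsto x (𝓝[<] b) (𝓝 0)) (hy : Tendsto y (𝓝[<] b) (𝓝 0))
    (hx' : ∀ s ∈ Ioo a b, x' s < 0) (hy' : ∀ s ∈ Ioo a b, y' s < 0) :
    ConeFlow l m a b (fun s => x s / √(x s ^ 2 + y s ^ 2)) (fun s => y s / √(x s ^ 2 + y s ^ 2))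
      (fun s => (x' s * y s - x s * y' s) / √(x s ^ 2 + y s ^ 2))
      (fun s => -(x s * x' s + y s * y' s) / √(x s ^ 2 + y s ^ 2))
      (fun s => √(x s ^ 2 + y s ^ 2)) h := by
  have hr : ∀ s ∈ Ioo a b, 0 < √(x s ^ 2 + y s ^ 2) := fun s hs => by
    have := hc.x_pos s hs
    positivity
  have hr2 : ∀ s, √(x s ^ 2 + y s ^ 2) ^ 2 = x s ^ 2 + y s ^ 2 := fun s =>
    Real.sq_sqrt (by positivity)
  have hCpos : ∀ s ∈ Ioo a b, 0 < -(x s * x' s + y s * y' s) := by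
    intro s hs
    have h1 := mul_neg_of_pos_of_neg (hc.x_pos s hs) (hx' s hs)
    have h2 := mul_neg_of_pos_of_neg (hc.y_pos s hs) (hy' s hs)
    linarith
  have heC : ∀ s ∈ Ioo a b, ((x' s * y s - x s * y' s) / √(x s ^ 2 + y s ^ 2)) ^ 2
      + (-(x s * x' s + y s * y' s) / √(x s ^ 2 + y s ^ 2)) ^ 2 = 1 := by
    intro s hs
    have := hr s hs
    rw [div_pow, div_pow, hr2, ← add_div, div_eq_one_iff_eq (by rw [← hr2]; positivity)]
    linear_combination (x s ^ 2 + y s ^ 2) * hc.unit s hs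
  have hT : ∀ s ∈ Ioo a b, ((l + m) * ((x' s * y s - x s * y' s) / √(x s ^ 2 + y s ^ 2))
      + (-(x s * x' s + y s * y' s) / √(x s ^ 2 + y s ^ 2))
        * (l * (y s / √(x s ^ 2 + y s ^ 2)) / (x s / √(x s ^ 2 + y s ^ 2))
          - m * (x s / √(x s ^ 2 + y s ^ 2)) / (y s / √(x s ^ 2 + y s ^ 2))))
      / √(x s ^ 2 + y s ^ 2) = -(l * y' s / x s - m * x' s / y s) := by
    intro s hs
    have h1 := (hr s hs).ne'
    have h2 := (hc.x_pos s hs).ne'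
    have h3 := (hc.y_pos s hs).ne'
    have h4 := hr2 s
    generalize √(x s ^ 2 + y s ^ 2) = ρ at *
    field_simp
    rw [h4]
    ring
  constructor
  · intro s hs
    have h1 := (hr s hs).ne'
    have h4 := hr2 s
    refine ((hc.hasDerivAt_x s hs).fun_div (hc.hasDerivAt_radius hs) h1).congr_deriv ?_
    generalize √(x s ^ 2 + y s ^ 2) = ρ at *
    field_simp
    linear_combination x' s * h4
  · intro s hs
    have h1 := (hr s hs).ne'
    have h4 := hr2 s
    refine ((hc.hasDerivAt_y s hs).fun_div (hc.hasDerivAt_radius hs) h1).congr_deriv ?_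
    generalize √(x s ^ 2 + y s ^ 2) = ρ at *
    field_simp
    linear_combination y' s * h4
  · intro s hs
    have h1 := (hr s hs).ne'
    have hT := hT s hs
    refine ((((hc.hasDerivAt_x' s hs).fun_mul (hc.hasDerivAt_y s hs)).fun_sub
      ((hc.hasDerivAt_x s hs).fun_mul (hc.hasDerivAt_y' s hs))).fun_div
      (hc.hasDerivAt_radius hs) h1).congr_deriv ?_
    generalize √(x s ^ 2 + y s ^ 2) = ρ at *
    generalize l * (y s / ρ) / (x s / ρ) - m * (x s / ρ) / (y s / ρ) = k at *
    generalize l * y' s / x s - m * x' s / y s = T at *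
    trans -(x s * x' s + y s * y' s) / ρ * (-T + (x' s * y s - x s * y' s) / ρ / ρ - h s)
    · field_simp
      ring
    · linear_combination (x s * x' s + y s * y' s) / ρ * hT
  · intro s hs
    have h1 := (hr s hs).ne'
    have hT := hT s hs
    have heC := heC s hs
    refine ((((hc.hasDerivAt_x s hs).fun_mul (hc.hasDerivAt_x' s hs)).fun_add
      ((hc.hasDerivAt_y s hs).fun_mul (hc.hasDerivAt_y' s hs))).fun_neg.fun_div
      (hc.hasDerivAt_radius hs) h1).congr_deriv ?_
    have h5 := hc.unit s hs
    generalize √(x s ^ 2 + y s ^ 2) = ρ at *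
    have h6 : (x' s * y s - x s * y' s) ^ 2 + (x s * x' s + y s * y' s) ^ 2 = ρ ^ 2 := by
      field_simp at heC
      linarith
    generalize l * (y s / ρ) / (x s / ρ) - m * (x s / ρ) / (y s / ρ) = k at *
    generalize l * y' s / x s - m * x' s / y s = T at *
    trans -((x' s * y s - x s * y' s) / ρ * (-T + (x' s * y s - x s * y' s) / ρ / ρ - h s))
    · field_simp
      linear_combination (-ρ ^ 2) * h5 + h6
    · linear_combination (x' s * y s - x s * y' s) / ρ * hT
  · exact fun s hs => div_pos (hc.x_pos s hs) (hr s hs)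
  · exact fun s hs => div_pos (hc.y_pos s hs) (hr s hs)
  · exact fun s hs => div_pos (hCpos s hs) (hr s hs)
  · exact hr
  · intro s hs
    have hd : ∀ s ∈ Ioo a b, HasDerivAt (fun t => √(x t ^ 2 + y t ^ 2) + t)
        ((x s * x' s + y s * y' s) / √(x s ^ 2 + y s ^ 2) + 1) s :=
      fun s hs => (hc.hasDerivAt_radius hs).fun_add (hasDerivAt_id' s)
    have hlim : Tendsto (fun t => √(x t ^ 2 + y t ^ 2) + t) (𝓝[<] b) (𝓝 b) := by
      have := (((hx.pow 2).add (hy.pow 2)).sqrt).add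
        (tendsto_nhdsWithin_of_tendsto_nhds (tendsto_id (x := 𝓝 b)) (s := Iio b))
      simpa using this
    have := le_of_hasDerivAt_nonneg_of_tendsto hd (fun s hs => ?_) hlim hs
    · linarith
    · have h1 := heC s hs
      rw [neg_div] at h1
      nlinarith [sq_nonneg ((x' s * y s - x s * y' s) / √(x s ^ 2 + y s ^ 2))]
  · intro s hs
    have := hr s hs
    rw [div_pow, div_pow, hr2, ← add_div, div_self]
    rw [← hr2]
    positivity
  · exact heC

/-- A generating curve running into the origin is asymptotic to the minimal cone. -/
lemma tendsto_x' (hc : ProfileCurve l m a b x y x' y' h) (hl : 1 ≤ l) (hm : 1 ≤ m)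
    (hab : a < b) (hx : Tendsto x (𝓝[<] b) (𝓝 0)) (hy : Tendsto y (𝓝[<] b) (𝓝 0)) {K δ : ℝ}
    (hK : ∀ s ∈ Ioo a b, |h s| ≤ K) (hδ : 0 < δ) (hδ' : δ * (l + m + 3) ≤ 1)
    (hxK : ∀ s ∈ Ioo a b, K * x s < δ) (hyK : ∀ s ∈ Ioo a b, K * y s < δ) :
    Tendsto x' (𝓝[<] b) (𝓝 (-√((l : ℝ) / (l + m)))) := by
  have hδl : δ * (l + 3) ≤ 1 := le_trans (by gcongr; linarith [m.cast_nonneg (α := ℝ)]) hδ'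
  have hδm : δ * (m + 3) ≤ 1 := le_trans (by gcongr; linarith [l.cast_nonneg (α := ℝ)]) hδ'
  have h1 := fun s hs => hc.neg_and_sq_lt hl hm hab hx hy hK hδm hxK hyK (s := s) hs
  have h2 := fun s hs => hc.swap.neg_and_sq_lt hm hl hab hy hx (K := K) (δ := δ)
    (fun s hs => by rw [abs_neg]; exact hK s hs) hδl hyK hxK (s := s) hs
  have hf := hc.coneFlow hx hy (fun s hs => (h1 s hs).1) (fun s hs => (h2 s hs).1)
  have hr2 : ∀ s, √(x s ^ 2 + y s ^ 2) ^ 2 = x s ^ 2 + y s ^ 2 := fun s =>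
    Real.sq_sqrt (by positivity)
  have hδ1 : δ ≤ 1 := by nlinarith [l.cast_nonneg (α := ℝ)]
  have hXδ : ∀ s ∈ Ioo a b, δ ≤ x s / √(x s ^ 2 + y s ^ 2) := by
    intro s hs
    have hr := hf.r_pos s hs
    have hx0 := hc.x_pos s hs
    rw [le_div_iff₀ hr]
    refine (sq_le_sq₀ (by positivity) hx0.le).1 ?_
    rw [mul_pow, hr2]
    have h3 := (h1 s hs).2
    calc δ ^ 2 * (x s ^ 2 + y s ^ 2) ≤ δ ^ 2 * ((m + 3) * x s ^ 2) := by gcongr; linarith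
      _ = δ * (δ * (m + 3)) * x s ^ 2 := by ring
      _ ≤ 1 * x s ^ 2 := by
        gcongr
        exact mul_le_one₀ hδ1 (by positivity) hδm
      _ = x s ^ 2 := one_mul _
  have hYδ : ∀ s ∈ Ioo a b, δ ≤ y s / √(x s ^ 2 + y s ^ 2) := by
    intro s hs
    have hr := hf.r_pos s hs
    have hy0 := hc.y_pos s hs
    rw [le_div_iff₀ hr]
    refine (sq_le_sq₀ (by positivity) hy0.le).1 ?_
    rw [mul_pow, hr2]
    have h3 := (h2 s hs).2
    calc δ ^ 2 * (x s ^ 2 + y s ^ 2) ≤ δ ^ 2 * ((l + 3) * y s ^ 2) := by gcongr; linarith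
      _ = δ * (δ * (l + 3)) * y s ^ 2 := by ring
      _ ≤ 1 * y s ^ 2 := by
        gcongr
        exact mul_le_one₀ hδ1 (by positivity) hδl
      _ = y s ^ 2 := one_mul _
  obtain ⟨hXlim, hClim⟩ := hf.tendsto_X_C hl hm hab hδ hXδ hYδ hK
  have hmem : ∀ᶠ s in 𝓝[<] b, s ∈ Ioo a b := Ioo_mem_nhdsLT hab
  have helim : Tendsto (fun s => (x' s * y s - x s * y' s) / √(x s ^ 2 + y s ^ 2))
      (𝓝[<] b) (𝓝 0) := by
    have h3 := ((hClim.pow 2).const_sub 1).sqrt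
    rw [one_pow, sub_self, Real.sqrt_zero] at h3
    rw [tendsto_zero_iff_abs_tendsto_zero]
    refine h3.congr' ?_
    filter_upwards [hmem] with s hs
    rw [Function.comp_apply, ← Real.sqrt_sq_eq_abs]
    congr 1
    linarith [hf.e_sq_add_C_sq s hs]
  have heY : Tendsto (fun s => (x' s * y s - x s * y' s) / √(x s ^ 2 + y s ^ 2)
      * (y s / √(x s ^ 2 + y s ^ 2))) (𝓝[<] b) (𝓝 0) := by
    rw [tendsto_zero_iff_abs_tendsto_zero] at helim ⊢
    refine squeeze_zero' (Eventually.of_forall fun s => abs_nonneg _) ?_ helim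
    filter_upwards [hmem] with s hs
    rw [Function.comp_apply, Function.comp_apply, abs_mul, abs_of_pos (hf.Y_pos s hs)]
    exact mul_le_of_le_one_right (abs_nonneg _) (hf.Y_le_one hs)
  have hlim := heY.sub (hClim.mul hXlim)
  rw [one_mul, zero_sub] at hlim
  refine hlim.congr' ?_
  filter_upwards [hmem] with s hs
  have hr := (hf.r_pos s hs).ne'
  have h4 := hr2 s
  generalize √(x s ^ 2 + y s ^ 2) = ρ at *
  field_simp
  linear_combination (-x' s) * h4

end ProfileCurve

end

/-- If the generating curve of an `O(l+1)×O(m+1)`-type hypersurface passes through the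
origin (`x → 0` and `y → 0` as `s → b⁻`), then `x'(s)² → l/(l+m)`, and in particular
`x'(s) → -√(l/(l+m))` as `s → b⁻`. -/
theorem stmt_13 (l m : ℕ) (hl : 1 ≤ l) (hm : 1 ≤ m) (b : ℝ) (hb : 0 < b)
    (H x y x' y' x'' y'' : ℝ → ℝ)
    (hx : ∀ s ∈ Set.Ico (0:ℝ) b, HasDerivWithinAt x (x' s) (Set.Ico 0 b) s)
    (hy : ∀ s ∈ Set.Ico (0:ℝ) b, HasDerivWithinAt y (y' s) (Set.Ico 0 b) s)
    (hx' : ∀ s ∈ Set.Ico (0:ℝ) b, HasDerivWithinAt x' (x'' s) (Set.Ico 0 b) s)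
    (hy' : ∀ s ∈ Set.Ico (0:ℝ) b, HasDerivWithinAt y' (y'' s) (Set.Ico 0 b) s)
    (hHc : ContinuousOn H (Set.Icc 0 b))
    (hxpos : ∀ s ∈ Set.Ico (0:ℝ) b, 0 < x s)
    (hypos : ∀ s ∈ Set.Ico (0:ℝ) b, 0 < y s)
    (hunit : ∀ s ∈ Set.Ico (0:ℝ) b, x' s ^ 2 + y' s ^ 2 = 1)
    (heq : ∀ s ∈ Set.Ico (0:ℝ) b,
      (l:ℝ) * y' s / x s - (m:ℝ) * x' s / y s - (x'' s * y' s - x' s * y'' s)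
        + ((l:ℝ) + (m:ℝ) + 1) * H s = 0)
    (hxlim : Filter.Tendsto x (nhdsWithin b (Set.Iio b)) (nhds 0))
    (hylim : Filter.Tendsto y (nhdsWithin b (Set.Iio b)) (nhds 0)) :
    Filter.Tendsto (fun s => x' s ^ 2) (nhdsWithin b (Set.Iio b))
        (nhds ((l:ℝ) / ((l:ℝ) + (m:ℝ)))) ∧
    Filter.Tendsto x' (nhdsWithin b (Set.Iio b))
        (nhds (-Real.sqrt ((l:ℝ) / ((l:ℝ) + (m:ℝ))))) := by
  have hsub : Set.Ioo 0 b ⊆ Set.Ico 0 b := Set.Ioo_subset_Ico_self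
  have hnhds : ∀ s ∈ Set.Ioo 0 b, Set.Ico 0 b ∈ nhds s := fun s hs => Ico_mem_nhds hs.1 hs.2
  have hc : ProfileCurve l m 0 b x y x' y' (fun s => (l + m + 1) * H s) := by
    have hmain : ∀ s ∈ Set.Ioo 0 b, x' s * x'' s + y' s * y'' s = 0 := by
      intro s hs
      have hd := (((hx' s (hsub hs)).hasDerivAt (hnhds s hs)).fun_pow 2).fun_add
        (((hy' s (hsub hs)).hasDerivAt (hnhds s hs)).fun_pow 2)
      have hconst : (fun t => x' t ^ 2 + y' t ^ 2) =ᶠ[nhds s] fun _ => 1 := by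
        filter_upwards [hnhds s hs] with t ht using hunit t ht
      have := hd.unique ((hasDerivAt_const s (1 : ℝ)).congr_of_eventuallyEq hconst)
      push_cast at this
      linarith
    refine ⟨fun s hs => (hx s (hsub hs)).hasDerivAt (hnhds s hs),
      fun s hs => (hy s (hsub hs)).hasDerivAt (hnhds s hs),
      fun s hs => ((hx' s (hsub hs)).hasDerivAt (hnhds s hs)).congr_deriv ?_,
      fun s hs => ((hy' s (hsub hs)).hasDerivAt (hnhds s hs)).congr_deriv ?_,
      fun s hs => hxpos s (hsub hs), fun s hs => hypos s (hsub hs),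
      fun s hs => hunit s (hsub hs)⟩
    · linear_combination x' s * hmain s hs - y' s * heq s (hsub hs) - x'' s * hunit s (hsub hs)
    · linear_combination y' s * hmain s hs + x' s * heq s (hsub hs) - y'' s * hunit s (hsub hs)
  obtain ⟨M, hM⟩ := isCompact_Icc.exists_bound_of_continuousOn hHc
  set K : ℝ := (l + m + 1) * M with hKdef
  have hK : ∀ s ∈ Set.Ioo 0 b, |(l + m + 1) * H s| ≤ K := by
    intro s hs
    rw [abs_mul, abs_of_nonneg (by positivity)]
    exact mul_le_mul_of_nonneg_left (hM s (Set.Ioo_subset_Icc_self hs)) (by positivity)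
  set δ : ℝ := 1 / (l + m + 3) with hδdef
  have hδ : 0 < δ := by positivity
  have hxK := hxlim.const_mul K
  have hyK := hylim.const_mul K
  rw [mul_zero] at hxK hyK
  obtain ⟨a, ha, hsmall⟩ := (mem_nhdsLT_iff_exists_mem_Ico_Ioo_subset hb).1
    ((hxK.eventually_lt_const hδ).and (hyK.eventually_lt_const hδ))
  have hIoo : Set.Ioo a b ⊆ Set.Ioo 0 b := Set.Ioo_subset_Ioo_left ha.1
  have hlim := (hc.mono ha.1).tendsto_x' hl hm ha.2 hxlim hylim (fun s hs => hK s (hIoo hs)) hδ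
    (by rw [hδdef, one_div_mul_cancel (by positivity)])
    (fun s hs => (hsmall hs).1) (fun s hs => (hsmall hs).2)
  refine ⟨?_, hlim⟩
  have hsq := hlim.pow 2
  rwa [neg_sq, Real.sq_sqrt (by positivity)] at hsq
end

section
/- Let l, m ≥ 1, n = l+m+2, and H̃ bounded on [0,Y] with x₀ > 0. Then for sufficiently large M and sufficiently small Y (with M Y² < 2x₀), there exists a unique continuous q on (0,Y] with sup_{y∈(0,Y]}|q(y)/y| ≤ M satisfying q(y) = y^{-m} ∫₀^y { -m q(η)³ + (n-1)H̃(η) η (1+q(η)²)^{3/2} + l η(1+q(η)²)/(∫₀^η q(ξ)dξ + x₀) } η^{m-1} dη. -/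
/-- Pointwise nonlinearity of the slope equation: `a` is the slope, `h` the mean curvature and
`A` the value of the nonlocal term. -/
noncomputable def slopeNonlinearity (l m : ℕ) (η h a A : ℝ) : ℝ :=
  -(m:ℝ) * a ^ 3 + ((l:ℝ) + (m:ℝ) + 1) * h * η * (1 + a ^ 2) ^ ((3:ℝ)/2)
    + (l:ℝ) * η * (1 + a ^ 2) / A

/-- The integrand on the right-hand side of the slope equation. -/
noncomputable def slopeIntegrand (l m : ℕ) (Ht : ℝ → ℝ) (x₀ : ℝ) (q : ℝ → ℝ) (η : ℝ) : ℝ :=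
  slopeNonlinearity l m η (Ht η) (q η) ((∫ ξ in (0:ℝ)..η, q ξ) + x₀) * η ^ (m - 1)

/-- Functions continuous on `(0, Y]` with `|q y| ≤ M y`. -/
def slopeClass (Y M : ℝ) : Set (ℝ → ℝ) :=
  {q | ContinuousOn q (Set.Ioc 0 Y) ∧ ∀ y ∈ Set.Ioc 0 Y, |q y| ≤ M * y}

/-- The weighted primitive `y ↦ y⁻ᵐ ∫₀ʸ f`. -/
noncomputable def weightedPrimitive (m : ℕ) (f : ℝ → ℝ) (y : ℝ) : ℝ :=
  y ^ (-(m:ℤ)) * ∫ η in (0:ℝ)..y, f η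

lemma abs_weightedPrimitive_le {m : ℕ} {f : ℝ → ℝ} {K y : ℝ} (hK : 0 ≤ K) (hy : 0 < y)
    (hf : ∀ η ∈ Set.Ioc 0 y, |f η| ≤ K * η ^ m) : |weightedPrimitive m f y| ≤ K * y := by
  have h : ‖∫ η in (0:ℝ)..y, f η‖ ≤ K * y ^ m * |y - 0| := by
    refine intervalIntegral.norm_integral_le_of_norm_le_const fun η hη => ?_
    rw [Set.uIoc_of_le hy.le] at hη
    refine (hf η hη).trans ?_
    have := hη.1.le
    have := hη.2
    gcongr
  rw [sub_zero, abs_of_pos hy, Real.norm_eq_abs] at h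
  have hp : 0 < y ^ m := by positivity
  rw [weightedPrimitive, abs_mul, zpow_neg, zpow_natCast, abs_of_pos (inv_pos.2 hp),
    inv_mul_le_iff₀ hp]
  linarith

lemma intervalIntegrable_zero_left_mono {f : ℝ → ℝ} {y Y : ℝ}
    (hf : IntervalIntegrable f MeasureTheory.volume 0 Y) (hy : y ∈ Set.Ioc 0 Y) :
    IntervalIntegrable f MeasureTheory.volume 0 y :=
  hf.mono_set (by
    rw [Set.uIcc_of_le hy.1.le, Set.uIcc_of_le (hy.1.le.trans hy.2)]
    exact Set.Icc_subset_Icc_right hy.2)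

lemma weightedPrimitive_mem_slopeClass {m : ℕ} {f : ℝ → ℝ} {Y M : ℝ} (hY : 0 < Y) (hM : 0 ≤ M)
    (hi : IntervalIntegrable f MeasureTheory.volume 0 Y)
    (hf : ∀ η ∈ Set.Ioc 0 Y, |f η| ≤ M * η ^ m) :
    weightedPrimitive m f ∈ slopeClass Y M := by
  refine ⟨ContinuousOn.mul ?_ ?_, fun y hy =>
    abs_weightedPrimitive_le hM hy.1 fun η hη => hf η ⟨hη.1, hη.2.trans hy.2⟩⟩
  · exact fun y hy => (continuousAt_zpow₀ y _ (Or.inl hy.1.ne')).continuousWithinAt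
  · have := intervalIntegral.continuousOn_primitive_interval' hi Set.left_mem_uIcc
    rw [Set.uIcc_of_le hY.le] at this
    exact this.mono Set.Ioc_subset_Icc_self

lemma abs_weightedPrimitive_sub_le {m : ℕ} {f g : ℝ → ℝ} {K y : ℝ} (hK : 0 ≤ K) (hy : 0 < y)
    (hf : IntervalIntegrable f MeasureTheory.volume 0 y)
    (hg : IntervalIntegrable g MeasureTheory.volume 0 y)
    (h : ∀ η ∈ Set.Ioc 0 y, |f η - g η| ≤ K * η ^ m) :
    |weightedPrimitive m f y - weightedPrimitive m g y| ≤ K * y := by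
  have : weightedPrimitive m f y - weightedPrimitive m g y
      = weightedPrimitive m (fun η => f η - g η) y := by
    simp only [weightedPrimitive, intervalIntegral.integral_sub hf hg, mul_sub]
  rw [this]
  exact abs_weightedPrimitive_le hK hy h

open Classical in
/-- The function `y ↦ y u(y)` on `(0, Y]`, extended by zero. -/
noncomputable def unweight {Y : ℝ} (u : BoundedContinuousFunction (Set.Ioc 0 Y) ℝ) (y : ℝ) : ℝ :=
  if h : y ∈ Set.Ioc 0 Y then y * u ⟨y, h⟩ else 0

lemma unweight_apply {Y y : ℝ} (u : BoundedContinuousFunction (Set.Ioc 0 Y) ℝ)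
    (hy : y ∈ Set.Ioc 0 Y) : unweight u y = y * u ⟨y, hy⟩ := dif_pos hy

lemma unweight_mem_slopeClass {Y M : ℝ} {u : BoundedContinuousFunction (Set.Ioc 0 Y) ℝ}
    (hu : ‖u‖ ≤ M) : unweight u ∈ slopeClass Y M := by
  constructor
  · rw [continuousOn_iff_continuous_domRestrict]
    have : (Set.Ioc 0 Y).domRestrict (unweight u) = fun y : Set.Ioc 0 Y => (y:ℝ) * u y := by
      ext y
      exact unweight_apply u y.2
    rw [this]
    fun_prop
  · intro y hy
    rw [unweight_apply u hy, abs_mul, abs_of_pos hy.1, mul_comm]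
    exact mul_le_mul_of_nonneg_right ((u.norm_coe_le_norm _).trans hu) hy.1.le

/-- The bounded continuous function `y ↦ q(y) / y` on `(0, Y]`. -/
noncomputable def weight {Y M : ℝ} {q : ℝ → ℝ} (hq : q ∈ slopeClass Y M) :
    BoundedContinuousFunction (Set.Ioc 0 Y) ℝ :=
  BoundedContinuousFunction.ofNormedAddCommGroup (fun y => q y / (y:ℝ))
    ((continuousOn_iff_continuous_domRestrict.1 hq.1).div continuous_subtype_val
      fun y => y.2.1.ne') M fun y => by
    rw [Real.norm_eq_abs, abs_div, abs_of_pos y.2.1, div_le_iff₀ y.2.1]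
    exact hq.2 y y.2

lemma existsUnique_eq_weightedPrimitive {m : ℕ} {Y M : ℝ} (hY : 0 < Y) (hM : 0 ≤ M)
    (Φ : (ℝ → ℝ) → ℝ → ℝ)
    (hintegrable : ∀ q ∈ slopeClass Y M, IntervalIntegrable (Φ q) MeasureTheory.volume 0 Y)
    (hbd : ∀ q ∈ slopeClass Y M, ∀ η ∈ Set.Ioc 0 Y, |Φ q η| ≤ M * η ^ m)
    (hlip : ∀ q ∈ slopeClass Y M, ∀ q' ∈ slopeClass Y M, ∀ D : ℝ, 0 ≤ D →
      (∀ y ∈ Set.Ioc 0 Y, |q y - q' y| ≤ D * y) →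
      ∀ η ∈ Set.Ioc 0 Y, |Φ q η - Φ q' η| ≤ D / 2 * η ^ m) :
    ∃ q ∈ slopeClass Y M, (∀ y ∈ Set.Ioc 0 Y, q y = weightedPrimitive m (Φ q) y) ∧
      ∀ q' ∈ slopeClass Y M, (∀ y ∈ Set.Ioc 0 Y, q' y = weightedPrimitive m (Φ q') y) →
        Set.EqOn q q' (Set.Ioc 0 Y) := by
  have hself : ∀ q ∈ slopeClass Y M, weightedPrimitive m (Φ q) ∈ slopeClass Y M := fun q hq =>
    weightedPrimitive_mem_slopeClass hY hM (hintegrable q hq) (hbd q hq)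
  have hcontr : ∀ q ∈ slopeClass Y M, ∀ q' ∈ slopeClass Y M, ∀ D : ℝ, 0 ≤ D →
      (∀ y ∈ Set.Ioc 0 Y, |q y - q' y| ≤ D * y) → ∀ y ∈ Set.Ioc 0 Y,
      |weightedPrimitive m (Φ q) y - weightedPrimitive m (Φ q') y| ≤ D / 2 * y := by
    intro q hq q' hq' D hD h y hy
    exact abs_weightedPrimitive_sub_le (by positivity) hy.1
      (intervalIntegrable_zero_left_mono (hintegrable q hq) hy)
      (intervalIntegrable_zero_left_mono (hintegrable q' hq') hy)
      fun η hη => hlip q hq q' hq' D hD h η ⟨hη.1, hη.2.trans hy.2⟩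
  obtain ⟨q, hq, hfix⟩ : ∃ q ∈ slopeClass Y M,
      ∀ y ∈ Set.Ioc 0 Y, q y = weightedPrimitive m (Φ q) y := by
    let B : Set (BoundedContinuousFunction (Set.Ioc 0 Y) ℝ) := Metric.closedBall 0 M
    have hB : ∀ u : B, unweight u.1 ∈ slopeClass Y M := fun u =>
      unweight_mem_slopeClass (mem_closedBall_zero_iff.1 u.2)
    let T : B → B := fun u => ⟨weight (hself _ (hB u)), mem_closedBall_zero_iff.2
      (BoundedContinuousFunction.norm_ofNormedAddCommGroup_le _ hM _)⟩
    have hT : ContractingWith (1 / 2) T := by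
      refine ⟨by rw [div_lt_one] <;> norm_num, LipschitzWith.of_dist_le_mul fun u v => ?_⟩
      have hd : ∀ y ∈ Set.Ioc 0 Y, |unweight u.1 y - unweight v.1 y| ≤ dist u v * y := by
        intro y hy
        rw [unweight_apply _ hy, unweight_apply _ hy, ← mul_sub, abs_mul, abs_of_pos hy.1, mul_comm]
        exact mul_le_mul_of_nonneg_right (BoundedContinuousFunction.dist_coe_le_dist
          (f := u.1) (g := v.1) ⟨y, hy⟩) hy.1.le
      refine (BoundedContinuousFunction.dist_le (by positivity)).2 fun y => ?_
      have := hcontr _ (hB u) _ (hB v) _ dist_nonneg hd y y.2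
      change |_ / (y:ℝ) - _ / (y:ℝ)| ≤ _
      rw [← sub_div, abs_div, abs_of_pos y.2.1, div_le_iff₀ y.2.1]
      refine this.trans (le_of_eq ?_)
      push_cast
      ring
    have : CompleteSpace B := Metric.isClosed_closedBall.completeSpace_coe
    have : Nonempty B := ⟨⟨0, by simpa [B] using hM⟩⟩
    let u := ContractingWith.fixedPoint T hT
    have hu : T u = u := hT.fixedPoint_isFixedPt
    refine ⟨unweight u.1, hB u, fun y hy => ?_⟩
    rw [unweight_apply _ hy]
    have : weightedPrimitive m (Φ (unweight u.1)) y / y = u.1 ⟨y, hy⟩ :=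
      congrArg (fun w : B => w.1 ⟨y, hy⟩) hu
    rw [← this, mul_div_cancel₀ _ hy.1.ne']
  refine ⟨q, hq, hfix, fun q' hq' hfix' y hy => ?_⟩
  have hiter : ∀ k : ℕ, ∀ y ∈ Set.Ioc 0 Y, |q y - q' y| ≤ 2 * M * (1 / 2) ^ k * y := by
    intro k
    induction k with
    | zero =>
      intro y hy
      have := abs_sub (q y) (q' y)
      linarith [hq.2 y hy, hq'.2 y hy]
    | succ k ih =>
      intro y hy
      rw [hfix y hy, hfix' y hy]
      refine (hcontr q hq q' hq' _ (by positivity) ih y hy).trans (le_of_eq ?_)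
      ring
  have hlim : Filter.Tendsto (fun k : ℕ => 2 * M * (1 / 2 : ℝ) ^ k * y) Filter.atTop (nhds 0) := by
    simpa using ((tendsto_pow_atTop_nhds_zero_of_lt_one (r := (1 / 2 : ℝ)) (by norm_num)
      (by norm_num)).const_mul (2 * M)).mul_const y
  have := ge_of_tendsto' hlim fun k => hiter k y hy
  exact sub_eq_zero.1 (abs_nonpos_iff.1 this)

lemma one_add_sq_rpow_eq (a : ℝ) : (1 + a ^ 2) ^ ((3:ℝ)/2) = √(1 + a ^ 2) ^ 3 := by
  rw [Real.sqrt_eq_rpow, ← Real.rpow_mul_natCast (by positivity)]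
  norm_num

lemma one_add_sq_rpow_le {a : ℝ} (ha : |a| ≤ 1) : (1 + a ^ 2) ^ ((3:ℝ)/2) ≤ 4 := by
  rw [one_add_sq_rpow_eq]
  have h2 : a ^ 2 ≤ 1 := by rwa [sq_le_one_iff_abs_le_one]
  have hs := Real.sq_sqrt (show (0:ℝ) ≤ 1 + a ^ 2 by positivity)
  have h0 := Real.sqrt_nonneg (1 + a ^ 2)
  have : √(1 + a ^ 2) ≤ 2 := by nlinarith
  nlinarith

lemma abs_one_add_sq_rpow_sub_le {a b : ℝ} (ha : |a| ≤ 1) (hb : |b| ≤ 1) :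
    |(1 + a ^ 2) ^ ((3:ℝ)/2) - (1 + b ^ 2) ^ ((3:ℝ)/2)| ≤ 6 * |a - b| := by
  rw [one_add_sq_rpow_eq, one_add_sq_rpow_eq]
  have ha2 : a ^ 2 ≤ 1 := by rwa [sq_le_one_iff_abs_le_one]
  have hb2 : b ^ 2 ≤ 1 := by rwa [sq_le_one_iff_abs_le_one]
  have hs := Real.sq_sqrt (show (0:ℝ) ≤ 1 + a ^ 2 by positivity)
  have ht := Real.sq_sqrt (show (0:ℝ) ≤ 1 + b ^ 2 by positivity)
  have hs1 : 1 ≤ √(1 + a ^ 2) := Real.one_le_sqrt.2 (by nlinarith)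
  have ht1 : 1 ≤ √(1 + b ^ 2) := Real.one_le_sqrt.2 (by nlinarith)
  set s := √(1 + a ^ 2)
  set t := √(1 + b ^ 2)
  have hst : |s - t| * (s + t) = |a - b| * |a + b| := by
    rw [← abs_of_pos (show 0 < s + t by linarith), ← abs_mul, ← abs_mul]
    congr 1
    nlinarith
  have hab : |a + b| ≤ 2 := (abs_add_le a b).trans (by linarith)
  have hd : |s - t| ≤ |a - b| := by
    nlinarith [abs_nonneg (s - t), abs_nonneg (a - b)]
  rw [show s ^ 3 - t ^ 3 = (s ^ 2 + s * t + t ^ 2) * (s - t) by ring, abs_mul,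
    abs_of_pos (show 0 < s ^ 2 + s * t + t ^ 2 by positivity)]
  have : s ^ 2 + s * t + t ^ 2 ≤ 6 := by nlinarith [sq_nonneg (s - t)]
  gcongr

lemma abs_slopeNonlinearity_le {l m : ℕ} {M C x₀ η h a A : ℝ} (hη : 0 < η)
    (hx₀ : 0 < x₀) (ha : |a| ≤ M * η) (hMη : M * η ≤ 1) (hM3 : m * M ^ 3 * η ^ 2 ≤ 1)
    (hh : |h| ≤ C) (hA : x₀ / 2 ≤ A) :
    |slopeNonlinearity l m η h a A| ≤ (1 + 4 * (l + m + 1) * C + 4 * l / x₀) * η := by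
  have ha1 := ha.trans hMη
  have ha2 : a ^ 2 ≤ 1 := by rwa [sq_le_one_iff_abs_le_one]
  have hA0 : 0 < A := by linarith
  have h1 : |-(m:ℝ) * a ^ 3| ≤ 1 * η := by
    rw [abs_mul, abs_neg, Nat.abs_cast, abs_pow]
    calc (m:ℝ) * |a| ^ 3 ≤ m * (M * η) ^ 3 := by gcongr
      _ = m * M ^ 3 * η ^ 2 * η := by ring
      _ ≤ 1 * η := by gcongr
  have h2 : |((l:ℝ) + (m:ℝ) + 1) * h * η * (1 + a ^ 2) ^ ((3:ℝ)/2)|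
      ≤ (l + m + 1) * C * η * 4 := by
    rw [abs_mul, abs_mul, abs_mul, abs_of_pos hη, abs_of_pos (show (0:ℝ) < l + m + 1 by positivity),
      abs_of_nonneg (show 0 ≤ (1 + a ^ 2) ^ ((3:ℝ)/2) by positivity)]
    have := one_add_sq_rpow_le ha1
    have := (abs_nonneg h).trans hh
    gcongr
  have h3 : |(l:ℝ) * η * (1 + a ^ 2) / A| ≤ l * η * 2 / (x₀ / 2) := by
    rw [abs_of_nonneg (by positivity)]
    gcongr
    linarith
  refine (abs_add_three _ _ _).trans ((add_le_add (add_le_add h1 h2) h3).trans (le_of_eq ?_))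
  field_simp
  ring

lemma abs_slopeNonlinearity_sub_le {l m : ℕ} {M C D x₀ η h a b A B : ℝ} (hη : 0 < η)
    (hD : 0 ≤ D) (hx₀ : 0 < x₀) (ha : |a| ≤ M * η) (hb : |b| ≤ M * η) (hMη : M * η ≤ 1)
    (hh : |h| ≤ C) (hA : x₀ / 2 ≤ A) (hB : x₀ / 2 ≤ B)
    (hab : |a - b| ≤ D * η) (hAB : |A - B| ≤ D * η) :
    |slopeNonlinearity l m η h a A - slopeNonlinearity l m η h b B|
      ≤ (3 * m * M + 6 * (l + m + 1) * C + l * (4 / x₀ + 8 / x₀ ^ 2)) * η * (D * η) := by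
  have ha1 := ha.trans hMη
  have hb1 := hb.trans hMη
  have ha2 : a ^ 2 ≤ 1 := by rwa [sq_le_one_iff_abs_le_one]
  have hb2 : b ^ 2 ≤ 1 := by rwa [sq_le_one_iff_abs_le_one]
  have hA0 : 0 < A := by linarith
  have hB0 : 0 < B := by linarith
  have hM0 : 0 ≤ M * η := (abs_nonneg a).trans ha
  have h1 : |(m:ℝ) * ((a - b) * (a ^ 2 + a * b + b ^ 2))| ≤ m * (D * η * (3 * (M * η))) := by
    rw [abs_mul, abs_mul, Nat.abs_cast]
    have : |a ^ 2 + a * b + b ^ 2| ≤ 3 * (M * η) := by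
      refine (abs_add_three _ _ _).trans ?_
      rw [abs_pow, abs_mul, abs_pow]
      nlinarith [abs_nonneg a, abs_nonneg b]
    gcongr
  have h2 : |((l:ℝ) + (m:ℝ) + 1) * h * η * ((1 + a ^ 2) ^ ((3:ℝ)/2) - (1 + b ^ 2) ^ ((3:ℝ)/2))|
      ≤ (l + m + 1) * C * η * (6 * (D * η)) := by
    rw [abs_mul, abs_mul, abs_mul, abs_of_pos hη, abs_of_pos (show (0:ℝ) < l + m + 1 by positivity)]
    have h6 : |(1 + a ^ 2) ^ ((3:ℝ)/2) - (1 + b ^ 2) ^ ((3:ℝ)/2)| ≤ 6 * (D * η) :=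
      (abs_one_add_sq_rpow_sub_le ha1 hb1).trans (by linarith)
    have := (abs_nonneg h).trans hh
    gcongr
  have h3 : |(l:ℝ) * η * ((a - b) * (a + b) / A)| ≤ l * η * (D * η * 2 / (x₀ / 2)) := by
    rw [abs_mul, abs_div, abs_mul (a - b), abs_of_pos hA0,
      abs_of_nonneg (show 0 ≤ (l:ℝ) * η by positivity)]
    have : |a + b| ≤ 2 := (abs_add_le a b).trans (by linarith)
    gcongr
  have h4 : |(l:ℝ) * η * ((1 + b ^ 2) * (B - A) / (A * B))|
      ≤ l * η * (2 * (D * η) / (x₀ / 2 * (x₀ / 2))) := by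
    rw [abs_mul, abs_div, abs_mul (1 + b ^ 2), abs_of_pos (show 0 < A * B by positivity),
      abs_of_nonneg (show 0 ≤ (l:ℝ) * η by positivity),
      abs_of_nonneg (show 0 ≤ 1 + b ^ 2 by positivity), abs_sub_comm B A]
    gcongr
    linarith
  have heq : slopeNonlinearity l m η h a A - slopeNonlinearity l m η h b B
      = -((m:ℝ) * ((a - b) * (a ^ 2 + a * b + b ^ 2)))
        + ((l:ℝ) + (m:ℝ) + 1) * h * η * ((1 + a ^ 2) ^ ((3:ℝ)/2) - (1 + b ^ 2) ^ ((3:ℝ)/2))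
        + ((l:ℝ) * η * ((a - b) * (a + b) / A)
          + (l:ℝ) * η * ((1 + b ^ 2) * (B - A) / (A * B))) := by
    unfold slopeNonlinearity
    field_simp
    ring
  rw [heq]
  rw [← abs_neg] at h1
  refine (abs_add_three _ _ _).trans ((add_le_add (add_le_add h1 h2)
    ((abs_add_le _ _).trans (add_le_add h3 h4))).trans (le_of_eq ?_))
  field_simp
  ring

section slopeClass

open Set MeasureTheory

variable {l m : ℕ} {Ht q : ℝ → ℝ} {x₀ Y M : ℝ}

lemma slopeClass_mono {y : ℝ} (hq : q ∈ slopeClass Y M) (hy : y ≤ Y) : q ∈ slopeClass y M :=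
  ⟨hq.1.mono (Ioc_subset_Ioc_right hy), fun z hz => hq.2 z ⟨hz.1, hz.2.trans hy⟩⟩

lemma aemeasurable_of_mem_slopeClass (hq : q ∈ slopeClass Y M) :
    AEMeasurable q (volume.restrict (Ioc 0 Y)) :=
  hq.1.aemeasurable measurableSet_Ioc

lemma intervalIntegrable_of_abs_le {f : ℝ → ℝ} {K : ℝ} (hY : 0 ≤ Y)
    (hf : AEMeasurable f (volume.restrict (Ioc 0 Y))) (hK : ∀ y ∈ Ioc 0 Y, |f y| ≤ K) :
    IntervalIntegrable f volume 0 Y := by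
  rw [intervalIntegrable_iff_integrableOn_Ioc_of_le hY]
  exact IntegrableOn.of_bound measure_Ioc_lt_top hf.aestronglyMeasurable K
    ((ae_restrict_iff' measurableSet_Ioc).2 (Filter.Eventually.of_forall hK))

lemma intervalIntegrable_of_mem_slopeClass (hq : q ∈ slopeClass Y M) (hY : 0 ≤ Y) (hM : 0 ≤ M) :
    IntervalIntegrable q volume 0 Y :=
  intervalIntegrable_of_abs_le hY (aemeasurable_of_mem_slopeClass hq) fun y hy =>
    (hq.2 y hy).trans (mul_le_mul_of_nonneg_left hy.2 hM)

lemma aemeasurable_primitive_of_mem_slopeClass (hq : q ∈ slopeClass Y M) (hY : 0 ≤ Y)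
    (hM : 0 ≤ M) :
    AEMeasurable (fun η => ∫ ξ in (0:ℝ)..η, q ξ) (volume.restrict (Ioc 0 Y)) := by
  have := intervalIntegral.continuousOn_primitive_interval'
    (intervalIntegrable_of_mem_slopeClass hq hY hM) left_mem_uIcc
  rw [uIcc_of_le hY] at this
  exact (this.mono Ioc_subset_Icc_self).aemeasurable measurableSet_Ioc

lemma aemeasurable_slopeIntegrand (hq : q ∈ slopeClass Y M) (hY : 0 ≤ Y) (hM : 0 ≤ M)
    (hH : AEMeasurable Ht (volume.restrict (Ioc 0 Y))) :
    AEMeasurable (slopeIntegrand l m Ht x₀ q) (volume.restrict (Ioc 0 Y)) := by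
  have h1 := aemeasurable_of_mem_slopeClass hq
  have h2 := aemeasurable_primitive_of_mem_slopeClass hq hY hM
  unfold slopeIntegrand slopeNonlinearity
  fun_prop

/-- The mean curvature can be recovered measurably from the integrand. -/
lemma aemeasurable_of_aemeasurable_slopeIntegrand (hq : q ∈ slopeClass Y M) (hY : 0 ≤ Y)
    (hM : 0 ≤ M)
    (hF : AEMeasurable (slopeIntegrand l m Ht x₀ q) (volume.restrict (Ioc 0 Y))) :
    AEMeasurable Ht (volume.restrict (Ioc 0 Y)) := by
  have h1 := aemeasurable_of_mem_slopeClass hq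
  have h2 := aemeasurable_primitive_of_mem_slopeClass hq hY hM
  have h3 : AEMeasurable (fun η => (slopeIntegrand l m Ht x₀ q η / η ^ (m - 1)
      - slopeNonlinearity l m η 0 (q η) ((∫ ξ in (0:ℝ)..η, q ξ) + x₀))
      / (((l:ℝ) + (m:ℝ) + 1) * η * (1 + q η ^ 2) ^ ((3:ℝ)/2))) (volume.restrict (Ioc 0 Y)) := by
    unfold slopeNonlinearity
    fun_prop
  refine h3.congr ((ae_restrict_iff' measurableSet_Ioc).2 (Filter.Eventually.of_forall ?_))
  intro η hη
  have hη0 : 0 < η := hη.1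
  have hr : 0 < (1 + q η ^ 2) ^ ((3:ℝ)/2) := by positivity
  have hN : (0:ℝ) < l + m + 1 := by positivity
  simp only [slopeIntegrand]
  rw [mul_div_cancel_right₀ _ (by positivity), div_eq_iff (by positivity)]
  unfold slopeNonlinearity
  ring

lemma abs_primitive_le_of_abs_le {f : ℝ → ℝ} {D η : ℝ} (hη : η ∈ Ioc 0 Y) (hD : 0 ≤ D)
    (hf : ∀ y ∈ Ioc 0 Y, |f y| ≤ D * y) : |∫ ξ in (0:ℝ)..η, f ξ| ≤ D * η * η := by
  have : ‖∫ ξ in (0:ℝ)..η, f ξ‖ ≤ D * η * |η - 0| := by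
    refine intervalIntegral.norm_integral_le_of_norm_le_const fun ξ hξ => ?_
    rw [uIoc_of_le hη.1.le] at hξ
    exact (hf ξ ⟨hξ.1, hξ.2.trans hη.2⟩).trans (mul_le_mul_of_nonneg_left hξ.2 hD)
  rwa [sub_zero, abs_of_pos hη.1] at this

lemma half_le_primitive_add {η : ℝ} (hq : q ∈ slopeClass Y M) (hη : η ∈ Ioc 0 Y) (hM : 0 ≤ M)
    (hY1 : Y ≤ 1) (hMY : M * Y ≤ x₀ / 2) : x₀ / 2 ≤ (∫ ξ in (0:ℝ)..η, q ξ) + x₀ := by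
  have h1 := abs_le.1 (abs_primitive_le_of_abs_le hη hM hq.2)
  have h2 : M * η * η ≤ M * Y * 1 := by
    have := hη.1
    have := hη.2
    have : η ≤ 1 := by linarith
    have : 0 ≤ Y := by linarith
    gcongr
  linarith [h1.1]

lemma abs_slopeIntegrand_le {C η : ℝ} (hm : 1 ≤ m) (hq : q ∈ slopeClass Y M) (hη : η ∈ Ioc 0 Y)
    (hM : 0 ≤ M) (hx₀ : 0 < x₀) (hY1 : Y ≤ 1) (hMx : M * Y ≤ x₀ / 2) (hMY : M * Y ≤ 1)
    (hM3 : m * M ^ 3 * Y ≤ 1) (hh : |Ht η| ≤ C) :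
    |slopeIntegrand l m Ht x₀ q η| ≤ (1 + 4 * (l + m + 1) * C + 4 * l / x₀) * η ^ m := by
  have ⟨h0, hηY⟩ := hη
  have hη2 : η ^ 2 ≤ Y := by nlinarith
  have := abs_slopeNonlinearity_le (l := l) (m := m) h0 hx₀ (hq.2 η hη)
    ((mul_le_mul_of_nonneg_left hηY hM).trans hMY)
    ((mul_le_mul_of_nonneg_left hη2 (by positivity)).trans hM3) hh
    (half_le_primitive_add hq hη hM hY1 hMx)
  rw [slopeIntegrand, abs_mul, abs_of_pos (pow_pos h0 (m - 1))]
  refine (mul_le_mul_of_nonneg_right this (by positivity)).trans (le_of_eq ?_)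
  rw [mul_assoc, mul_pow_sub_one (by omega)]

lemma abs_slopeIntegrand_sub_le {q' : ℝ → ℝ} {C D η : ℝ} (hm : 1 ≤ m) (hq : q ∈ slopeClass Y M)
    (hq' : q' ∈ slopeClass Y M) (hη : η ∈ Ioc 0 Y) (hM : 0 ≤ M) (hC : 0 ≤ C) (hx₀ : 0 < x₀)
    (hY1 : Y ≤ 1) (hMx : M * Y ≤ x₀ / 2) (hMY : M * Y ≤ 1)
    (hL : (3 * m * M + 6 * (l + m + 1) * C + l * (4 / x₀ + 8 / x₀ ^ 2)) * Y ≤ 1 / 2)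
    (hh : |Ht η| ≤ C) (hD : 0 ≤ D) (hqq : ∀ y ∈ Ioc 0 Y, |q y - q' y| ≤ D * y) :
    |slopeIntegrand l m Ht x₀ q η - slopeIntegrand l m Ht x₀ q' η| ≤ D / 2 * η ^ m := by
  have ⟨h0, hηY⟩ := hη
  have hA : |((∫ ξ in (0:ℝ)..η, q ξ) + x₀) - ((∫ ξ in (0:ℝ)..η, q' ξ) + x₀)| ≤ D * η := by
    rw [add_sub_add_right_eq_sub, ← intervalIntegral.integral_sub
      (intervalIntegrable_of_mem_slopeClass (slopeClass_mono hq hηY) h0.le hM)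
      (intervalIntegrable_of_mem_slopeClass (slopeClass_mono hq' hηY) h0.le hM)]
    refine (abs_primitive_le_of_abs_le hη hD hqq).trans ?_
    exact mul_le_of_le_one_right (by positivity) (hηY.trans hY1)
  have := abs_slopeNonlinearity_sub_le (l := l) (m := m) h0 hD hx₀ (hq.2 η hη)
    (hq'.2 η hη) ((mul_le_mul_of_nonneg_left hηY hM).trans hMY) hh
    (half_le_primitive_add hq hη hM hY1 hMx) (half_le_primitive_add hq' hη hM hY1 hMx)
    (hqq η hη) hA
  have hL' := (mul_le_mul_of_nonneg_left hηY (show 0 ≤ 3 * m * M + 6 * (l + m + 1) * C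
    + l * (4 / x₀ + 8 / x₀ ^ 2) by positivity)).trans hL
  rw [slopeIntegrand, slopeIntegrand, ← sub_mul, abs_mul, abs_of_pos (pow_pos h0 (m - 1))]
  calc _ ≤ 1 / 2 * (D * η) * η ^ (m - 1) := by
        gcongr
        exact this.trans (by gcongr)
    _ = D / 2 * (η * η ^ (m - 1)) := by ring
    _ = D / 2 * η ^ m := by rw [mul_pow_sub_one (by omega)]

lemma existsUnique_slope {C : ℝ} (hm : 1 ≤ m) (hY : 0 < Y) (hM : 0 ≤ M) (hC : 0 ≤ C)
    (hx₀ : 0 < x₀) (hY1 : Y ≤ 1) (hMx : M * Y ≤ x₀ / 2) (hMY : M * Y ≤ 1)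
    (hM3 : m * M ^ 3 * Y ≤ 1) (hMC : 1 + 4 * (l + m + 1) * C + 4 * l / x₀ ≤ M)
    (hL : (3 * m * M + 6 * (l + m + 1) * C + l * (4 / x₀ + 8 / x₀ ^ 2)) * Y ≤ 1 / 2)
    (hh : ∀ η ∈ Ioc 0 Y, |Ht η| ≤ C) (hH : AEMeasurable Ht (volume.restrict (Ioc 0 Y))) :
    ∃ q ∈ slopeClass Y M,
      (∀ y ∈ Ioc 0 Y, q y = weightedPrimitive m (slopeIntegrand l m Ht x₀ q) y) ∧
      ∀ q' ∈ slopeClass Y M,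
        (∀ y ∈ Ioc 0 Y, q' y = weightedPrimitive m (slopeIntegrand l m Ht x₀ q') y) →
        EqOn q q' (Ioc 0 Y) := by
  have hbd : ∀ q ∈ slopeClass Y M, ∀ η ∈ Ioc 0 Y, |slopeIntegrand l m Ht x₀ q η| ≤ M * η ^ m := by
    intro q hq η hη
    refine (abs_slopeIntegrand_le hm hq hη hM hx₀ hY1 hMx hMY hM3 (hh η hη)).trans ?_
    have := hη.1
    gcongr
  refine existsUnique_eq_weightedPrimitive hY hM (slopeIntegrand l m Ht x₀) (fun q hq => ?_) hbd
    fun q hq q' hq' D hD h η hη => abs_slopeIntegrand_sub_le hm hq hq' hη hM hC hx₀ hY1 hMx hMY hL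
      (hh η hη) hD h
  refine intervalIntegrable_of_abs_le (K := M * Y ^ m) hY.le
    (aemeasurable_slopeIntegrand hq hY.le hM hH) fun η hη => (hbd q hq η hη).trans ?_
  have := hη.1.le
  have := hη.2
  gcongr

/-- If the mean curvature is measurable near zero on no interval, then all the integrals take the
default value zero, and so does the solution. -/
lemma existsUnique_slope_of_not_aemeasurable (hM : 0 ≤ M)
    (hH : ∀ y ∈ Ioc 0 Y, ¬ AEMeasurable Ht (volume.restrict (Ioc 0 y))) :
    ∃ q ∈ slopeClass Y M,
      (∀ y ∈ Ioc 0 Y, q y = weightedPrimitive m (slopeIntegrand l m Ht x₀ q) y) ∧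
      ∀ q' ∈ slopeClass Y M,
        (∀ y ∈ Ioc 0 Y, q' y = weightedPrimitive m (slopeIntegrand l m Ht x₀ q') y) →
        EqOn q q' (Ioc 0 Y) := by
  have hzero : ∀ q ∈ slopeClass Y M, ∀ y ∈ Ioc 0 Y,
      weightedPrimitive m (slopeIntegrand l m Ht x₀ q) y = 0 := by
    intro q hq y hy
    rw [weightedPrimitive, intervalIntegral.integral_undef, mul_zero]
    exact fun hi => hH y hy (aemeasurable_of_aemeasurable_slopeIntegrand
      (slopeClass_mono hq hy.2) hy.1.le hM hi.1.aestronglyMeasurable.aemeasurable)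
  have h0 : (fun _ => 0 : ℝ → ℝ) ∈ slopeClass Y M :=
    ⟨continuousOn_const, fun y hy => by simpa using mul_nonneg hM hy.1.le⟩
  exact ⟨_, h0, fun y hy => (hzero _ h0 y hy).symm, fun q' hq' h y hy =>
    ((h y hy).trans (hzero q' hq' y hy)).symm⟩

lemma mem_slopeClass_iff :
    q ∈ slopeClass Y M ↔ ContinuousOn q (Ioc 0 Y) ∧ ∀ y ∈ Ioc (0:ℝ) Y, |q y / y| ≤ M := by
  refine and_congr_right fun _ => forall₂_congr fun y hy => ?_
  rw [abs_div, abs_of_pos hy.1, div_le_iff₀ hy.1]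

end slopeClass

/-- Existence and uniqueness for the integral equation (with nonlocal term) satisfied by the
slope `q = x'/y'` of the generating curve of an `O(l+1)×O(m+1)`-type hypersurface
(`n = l+m+2`) meeting the `x`-axis at `(x₀, 0)`, `x₀ > 0`, in the class
`X_{Y,M} = {q ∈ C(0,Y] : sup |q(y)/y| ≤ M}`, for sufficiently large `M` and small `Y`
with `M Y² < 2 x₀`. -/
theorem stmt_16 (l m : ℕ) (hl : 1 ≤ l) (hm : 1 ≤ m) (Y : ℝ) (hY : 0 < Y)
    (Ht : ℝ → ℝ) (hHt : ∃ C : ℝ, ∀ y ∈ Set.Icc (0:ℝ) Y, |Ht y| ≤ C)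
    (x₀ : ℝ) (hx₀ : 0 < x₀) :
    ∃ M₀ > (0:ℝ), ∀ M ≥ M₀, ∃ Y₂ > (0:ℝ), M * Y₂ ^ 2 < 2 * x₀ ∧
      ∀ Y₁, 0 < Y₁ → Y₁ ≤ Y₂ → Y₁ ≤ Y →
      ∃ q : ℝ → ℝ,
        (ContinuousOn q (Set.Ioc 0 Y₁) ∧
          (∀ y ∈ Set.Ioc (0:ℝ) Y₁, |q y / y| ≤ M) ∧
          (∀ y ∈ Set.Ioc (0:ℝ) Y₁,
            q y = y ^ (-(m:ℤ)) *
              ∫ η in (0:ℝ)..y,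
                (-(m:ℝ) * q η ^ 3
                  + ((l:ℝ) + (m:ℝ) + 1) * Ht η * η * (1 + q η ^ 2) ^ ((3:ℝ)/2)
                  + (l:ℝ) * η * (1 + q η ^ 2)
                      / ((∫ ξ in (0:ℝ)..η, q ξ) + x₀)) * η ^ (m - 1))) ∧
        (∀ q' : ℝ → ℝ,
          (ContinuousOn q' (Set.Ioc 0 Y₁) ∧
            (∀ y ∈ Set.Ioc (0:ℝ) Y₁, |q' y / y| ≤ M) ∧
            (∀ y ∈ Set.Ioc (0:ℝ) Y₁,
              q' y = y ^ (-(m:ℤ)) *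
                ∫ η in (0:ℝ)..y,
                  (-(m:ℝ) * q' η ^ 3
                    + ((l:ℝ) + (m:ℝ) + 1) * Ht η * η * (1 + q' η ^ 2) ^ ((3:ℝ)/2)
                    + (l:ℝ) * η * (1 + q' η ^ 2)
                        / ((∫ ξ in (0:ℝ)..η, q' ξ) + x₀)) * η ^ (m - 1))) →
          Set.EqOn q q' (Set.Ioc 0 Y₁)) := by
  obtain ⟨C₀, hC₀⟩ := hHt
  obtain ⟨C, hC, hHC⟩ : ∃ C : ℝ, 0 ≤ C ∧ ∀ y ∈ Set.Icc (0:ℝ) Y, |Ht y| ≤ C :=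
    ⟨|C₀|, abs_nonneg _, fun y hy => (hC₀ y hy).trans (le_abs_self _)⟩
  refine ⟨1 + 4 * (l + m + 1) * C + 4 * l / x₀, by positivity, fun M hMC => ?_⟩
  have hM : 0 ≤ M := le_trans (by positivity) hMC
  suffices ∃ Y₂ > (0:ℝ), M * Y₂ ^ 2 < 2 * x₀ ∧ ∀ Y₁, 0 < Y₁ → Y₁ ≤ Y₂ → Y₁ ≤ Y →
      ∃ q ∈ slopeClass Y₁ M,
        (∀ y ∈ Set.Ioc 0 Y₁, q y = weightedPrimitive m (slopeIntegrand l m Ht x₀ q) y) ∧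
        ∀ q' ∈ slopeClass Y₁ M,
          (∀ y ∈ Set.Ioc 0 Y₁, q' y = weightedPrimitive m (slopeIntegrand l m Ht x₀ q') y) →
          Set.EqOn q q' (Set.Ioc 0 Y₁) by
    obtain ⟨Y₂, hY₂, hMY₂, h⟩ := this
    refine ⟨Y₂, hY₂, hMY₂, fun Y₁ h0 h1 h2 => ?_⟩
    obtain ⟨q, hq, hfix, huniq⟩ := h Y₁ h0 h1 h2
    obtain ⟨hc, hb⟩ := mem_slopeClass_iff.1 hq
    exact ⟨q, ⟨hc, hb, hfix⟩, fun q' ⟨hc', hb', hfix'⟩ =>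
      huniq q' (mem_slopeClass_iff.2 ⟨hc', hb'⟩) hfix'⟩
  set L := 3 * m * M + 6 * (l + m + 1) * C + l * (4 / x₀ + 8 / x₀ ^ 2) with hLdef
  have hL : 0 ≤ L := by positivity
  set Z := 1 + M + 2 * M / x₀ + m * M ^ 3 + 2 * L with hZdef
  have hZ : 0 < Z := by positivity
  have hZ1 : 0 ≤ 2 * M / x₀ := by positivity
  have hZ2 : 0 ≤ m * M ^ 3 := by positivity
  have hsmall : ∀ Y₁, 0 < Y₁ → Y₁ ≤ 1 / Z → Y₁ ≤ 1 ∧ M * Y₁ ≤ x₀ / 2 ∧ M * Y₁ ≤ 1 ∧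
      m * M ^ 3 * Y₁ ≤ 1 ∧ L * Y₁ ≤ 1 / 2 := by
    intro Y₁ h0 h1
    rw [le_div_iff₀ hZ, mul_comm] at h1
    have key : ∀ c, c ≤ Z → c * Y₁ ≤ 1 := fun c hc =>
      (mul_le_mul_of_nonneg_right hc h0.le).trans h1
    have k1 := key 1 (by linarith)
    have k2 := key (2 * M / x₀) (by linarith)
    have k3 := key (2 * L) (by linarith)
    rw [div_mul_eq_mul_div, div_le_one hx₀] at k2
    exact ⟨by linarith, by linarith, key M (by linarith), key _ (by linarith), by linarith⟩
  have hsq : ∀ Y₂, 0 < Y₂ → Y₂ ≤ 1 / Z → M * Y₂ ^ 2 < 2 * x₀ := by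
    intro Y₂ h0 h1
    obtain ⟨k1, k2, -⟩ := hsmall Y₂ h0 h1
    nlinarith [mul_nonneg hM h0.le]
  by_cases hH : ∃ y ∈ Set.Ioc 0 Y,
      AEMeasurable Ht (MeasureTheory.volume.restrict (Set.Ioc 0 y))
  · obtain ⟨y, hy, hmeas⟩ := hH
    refine ⟨min y (1 / Z), lt_min hy.1 (by positivity),
      hsq _ (lt_min hy.1 (by positivity)) (min_le_right _ _), fun Y₁ h0 h1 h2 => ?_⟩
    obtain ⟨k1, k2, k3, k4, k5⟩ := hsmall Y₁ h0 (h1.trans (min_le_right _ _))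
    exact existsUnique_slope hm h0 hM hC hx₀ k1 k2 k3 k4 hMC k5
      (fun η hη => hHC η ⟨hη.1.le, hη.2.trans h2⟩)
      (hmeas.mono_measure (MeasureTheory.Measure.restrict_mono
        (Set.Ioc_subset_Ioc_right (h1.trans (min_le_left _ _))) le_rfl))
  · push Not at hH
    exact ⟨1 / Z, by positivity, hsq _ (by positivity) le_rfl, fun Y₁ _ _ h2 =>
      existsUnique_slope_of_not_aemeasurable hM fun y hy => hH y ⟨hy.1, hy.2.trans h2⟩⟩
end
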